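/- arXiv:2408.12327 — 2 statements merged into one kernel-verified Lean document; each statement's English description precedes it below -/
import Mathlib

section
/- Suppose either 1 < p < Q and 0 < h ≤ Qp/(Q−p), or p = Q > 1 and h > 0. Let 1 < q < p and 0 < δ < ∞, and let u ∈ N^{1,p}(X) be pointwise defined everywhere by its precise representative. Then the set E = { x ∈ X : ∫_0^δ ( ⨍_{B(x,r)} |u − u(x)|^h dμ )^{p/(h(p−1))} dr/r = ∞ } satisfies C_q(E) = 0. -/
open MeasureTheory Metric Filter ENNReal Topology

/-- A nonnegative (extended-real valued) function `g` on `X` is an *upper gradient* of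
`u : X → ℝ` if for every rectifiable curve, parametrized by arc length (equivalently, every
`1`-Lipschitz curve) `γ : [0, l] → X`, one has `|u(γ 0) − u(γ l)| ≤ ∫_0^l g(γ t) dt`. -/
def IsUpperGradient {X : Type*} [MetricSpace X] (u : X → ℝ) (g : X → ℝ≥0∞) : Prop :=
  ∀ (l : ℝ) (γ : ℝ → X), 0 < l → LipschitzOnWith 1 γ (Set.Icc 0 l) →
    ENNReal.ofReal |u (γ 0) - u (γ l)| ≤ ∫⁻ t in Set.Icc (0 : ℝ) l, g (γ t)

/-- `u` belongs to the Newtonian–Sobolev space `N^{1,q}(X)`: `u` is `q`-integrable and has a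
`q`-integrable (Borel measurable) upper gradient. -/
def MemN1p {X : Type*} [MetricSpace X] [MeasurableSpace X]
    (μ : Measure X) (q : ℝ) (u : X → ℝ) : Prop :=
  Measurable u ∧ (∫⁻ x, ENNReal.ofReal |u x| ^ q ∂μ) < ⊤ ∧
    ∃ g : X → ℝ≥0∞, Measurable g ∧ IsUpperGradient u g ∧ (∫⁻ x, g x ^ q ∂μ) < ⊤

/-- The Sobolev `q`-capacity of `E ⊆ X`:
`C_q(E) = inf { ‖u‖_{N^{1,q}}^q : u ∈ N^{1,q}(X), u ≥ 1 on E }`, where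
`‖u‖_{N^{1,q}}^q = ∫_X |u|^q dμ + inf_g ∫_X g^q dμ`, the inner infimum being over all
(measurable) upper gradients `g` of `u`. -/
noncomputable def sobolevCapacity {X : Type*} [MetricSpace X] [MeasurableSpace X]
    (μ : Measure X) (q : ℝ) (E : Set X) : ℝ≥0∞ :=
  ⨅ (u : X → ℝ) (_ : MemN1p μ q u ∧ ∀ x ∈ E, 1 ≤ u x),
    ((∫⁻ x, ENNReal.ofReal |u x| ^ q ∂μ) +
      ⨅ (g : X → ℝ≥0∞) (_ : Measurable g ∧ IsUpperGradient u g), ∫⁻ x, g x ^ q ∂μ)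

set_option linter.unusedSectionVars false

lemma sub_curve {X : Type*} [MetricSpace X] {w : X → ℝ} {g : X → ℝ≥0∞}
    (hw : IsUpperGradient w g) {l : ℝ} {γ : ℝ → X} (hγ : LipschitzOnWith 1 γ (Set.Icc 0 l))
    {s t : ℝ} (hs : 0 ≤ s) (hst : s ≤ t) (ht : t ≤ l) :
    ENNReal.ofReal |w (γ s) - w (γ t)| ≤ ∫⁻ τ in Set.Icc s t, g (γ τ) := by
  rcases hst.eq_or_lt with rfl | hlt
  · simp
  have h1 : LipschitzOnWith 1 (fun τ => γ (s + τ)) (Set.Icc 0 (t - s)) := by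
    intro x hx y hy
    have := hγ (x := s + x) ⟨by linarith [hx.1], by linarith [hx.2]⟩ (y := s + y)
      ⟨by linarith [hy.1], by linarith [hy.2]⟩
    simpa using this
  have h2 := hw (t - s) (fun τ => γ (s + τ)) (by linarith) h1
  have h3 := (measurePreserving_add_left (volume : Measure ℝ) s).setLIntegral_comp_preimage_emb
    (measurableEmbedding_addLeft s) (fun τ => g (γ τ)) (Set.Icc s t)
  have h4 : (fun x => s + x) ⁻¹' Set.Icc s t = Set.Icc 0 (t - s) := by
    ext x; simp only [Set.mem_preimage, Set.mem_Icc]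
    constructor <;> rintro ⟨h, h'⟩ <;> constructor <;> linarith
  rw [h4] at h3
  rw [← h3]
  simpa using h2

lemma trunc_real_aux {w : ℝ → ℝ} {G : ℝ → ℝ≥0∞} {l a b : ℝ} (hl : 0 < l) (hab : a ≤ b)
    (hw : ContinuousOn w (Set.Icc 0 l))
    (hG : ∀ s t, 0 ≤ s → s ≤ t → t ≤ l →
      ENNReal.ofReal |w s - w t| ≤ ∫⁻ τ in Set.Icc s t, G τ)
    (hlt : max a (min b (w 0)) < max a (min b (w l))) :
    ENNReal.ofReal |max a (min b (w 0)) - max a (min b (w l))| ≤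
      ∫⁻ τ in Set.Icc 0 l, Set.indicator {τ | a < w τ ∧ w τ < b} G τ := by
  set α := max a (min b (w 0)) with hα
  set β := max a (min b (w l)) with hβ
  have hαa : a ≤ α := le_max_left _ _
  have hβb : β ≤ b := max_le hab (min_le_left _ _)
  have h0 : w 0 ≤ α := by
    rcases le_total b (w 0) with h | h
    · have : α = b := by rw [hα, min_eq_left h, max_eq_right hab]
      linarith
    · rw [hα, min_eq_right h]; exact le_max_right _ _
  have hl' : β ≤ w l := by
    rw [hβ]
    apply max_le _ (min_le_right _ _)
    by_contra hc
    push Not at hc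
    have : β = a := by rw [hβ]; exact max_eq_left ((min_le_right _ _).trans hc.le)
    linarith
  have hS : IsCompact (Set.Icc 0 l ∩ w ⁻¹' Set.Iic α) :=
    isCompact_Icc.of_isClosed_subset (hw.preimage_isClosed_of_isClosed isClosed_Icc isClosed_Iic) Set.inter_subset_left
  obtain ⟨s, hs, hsmax⟩ := hS.exists_isGreatest ⟨0, ⟨le_rfl, hl.le⟩, h0⟩
  have hw' : ContinuousOn w (Set.Icc s l) := hw.mono (Set.Icc_subset_Icc_left hs.1.1)
  have hT : IsCompact (Set.Icc s l ∩ w ⁻¹' Set.Ici β) :=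
    isCompact_Icc.of_isClosed_subset (hw'.preimage_isClosed_of_isClosed isClosed_Icc isClosed_Ici)
      Set.inter_subset_left
  obtain ⟨t, ht, htmin⟩ := hT.exists_isLeast ⟨l, ⟨hs.1.2, le_rfl⟩, hl'⟩
  have hws : w s ≤ α := hs.2
  have hwt : β ≤ w t := ht.2
  calc ENNReal.ofReal |α - β| ≤ ENNReal.ofReal |w s - w t| := by
        apply ENNReal.ofReal_le_ofReal
        rw [abs_of_neg (by linarith), abs_of_neg (by linarith)]
        linarith
    _ ≤ ∫⁻ τ in Set.Icc s t, G τ := hG s t hs.1.1 ht.1.1 ht.1.2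
    _ = ∫⁻ τ in Set.Ioo s t, G τ := by rw [Measure.restrict_congr_set Ioo_ae_eq_Icc]
    _ = ∫⁻ τ in Set.Ioo s t, Set.indicator {τ | a < w τ ∧ w τ < b} G τ := by
        apply setLIntegral_congr_fun measurableSet_Ioo
        intro τ hτ
        have h1 : α < w τ := by
          by_contra hc
          push Not at hc
          exact absurd (hsmax ⟨⟨hs.1.1.trans hτ.1.le, hτ.2.le.trans ht.1.2⟩, hc⟩) (not_le.2 hτ.1)
        have h2 : w τ < β := by
          by_contra hc
          push Not at hc
          exact absurd (htmin ⟨⟨hτ.1.le, hτ.2.le.trans ht.1.2⟩, hc⟩) (not_le.2 hτ.2)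
        exact (Set.indicator_of_mem (s := {τ | a < w τ ∧ w τ < b})
          ⟨hαa.trans_lt h1, h2.trans_le hβb⟩ G).symm
    _ ≤ _ := lintegral_mono_set
        (Set.Ioo_subset_Icc_self.trans (Set.Icc_subset_Icc hs.1.1 ht.1.2))

lemma clamp_neg (a b x : ℝ) (hab : a ≤ b) :
    max (-b) (min (-a) (-x)) = - max a (min b x) := by
  rw [min_neg_neg, max_neg_neg, neg_inj, max_comm, min_comm]
  rcases le_total a x with h | h <;> rcases le_total b x with h' | h' <;>
    simp [h, h', hab] <;> linarith

lemma trunc_real {w : ℝ → ℝ} {G : ℝ → ℝ≥0∞} {l a b : ℝ} (hl : 0 < l) (hab : a ≤ b)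
    (hw : ContinuousOn w (Set.Icc 0 l))
    (hG : ∀ s t, 0 ≤ s → s ≤ t → t ≤ l →
      ENNReal.ofReal |w s - w t| ≤ ∫⁻ τ in Set.Icc s t, G τ) :
    ENNReal.ofReal |max a (min b (w 0)) - max a (min b (w l))| ≤
      ∫⁻ τ in Set.Icc 0 l, Set.indicator {τ | a < w τ ∧ w τ < b} G τ := by
  rcases lt_trichotomy (max a (min b (w 0))) (max a (min b (w l))) with h | h | h
  · exact trunc_real_aux hl hab hw hG h
  · simp [h]
  · have := trunc_real_aux (w := fun t => - w t) (G := G) (a := -b) (b := -a) hl (by linarith)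
      hw.neg (by
        intro s t h1 h2 h3
        have := hG s t h1 h2 h3
        rwa [← abs_neg, show -(-w s - -w t) = w s - w t by ring])
      (by rw [clamp_neg _ _ _ hab, clamp_neg _ _ _ hab]; linarith)
    rw [clamp_neg _ _ _ hab, clamp_neg _ _ _ hab, ← abs_neg] at this
    convert this using 3
    · ring_nf
    · congr 1
      ext τ
      simp only [Set.mem_ofPred_eq]
      constructor <;> rintro ⟨h, h'⟩ <;> constructor <;> linarith

lemma cont_of_modulus {w : ℝ → ℝ} {G : ℝ → ℝ≥0∞} {l : ℝ}
    (hG : ∀ s t, 0 ≤ s → s ≤ t → t ≤ l →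
      ENNReal.ofReal |w s - w t| ≤ ∫⁻ τ in Set.Icc s t, G τ)
    (hfin : ∫⁻ τ in Set.Icc 0 l, G τ ≠ ⊤) : ContinuousOn w (Set.Icc 0 l) := by
  rw [Metric.continuousOn_iff]
  intro x hx ε hε
  obtain ⟨d, hd, hdd⟩ := exists_pos_setLIntegral_lt_of_measure_lt hfin
    (ε := ENNReal.ofReal ε) (by simpa using hε)
  obtain ⟨d', hd'0, hd'⟩ : ∃ d' : ℝ, 0 < d' ∧ ENNReal.ofReal d' ≤ d := by
    rcases eq_or_ne d ⊤ with rfl | h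
    · exact ⟨1, one_pos, le_top⟩
    · exact ⟨d.toReal, ENNReal.toReal_pos hd.ne' h, by rw [ENNReal.ofReal_toReal h]⟩
  have key : ∀ s t, 0 ≤ s → s ≤ t → t ≤ l → t - s < d' → |w s - w t| < ε := by
    intro s t h1 h2 h3 h4
    have h5 := hG s t h1 h2 h3
    have h6 := hdd (Set.Icc s t) (by
      calc _ ≤ volume (Set.Icc s t) := Measure.restrict_apply_le _ _
        _ = ENNReal.ofReal (t - s) := Real.volume_Icc
        _ < ENNReal.ofReal d' := (ENNReal.ofReal_lt_ofReal_iff hd'0).2 h4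
        _ ≤ d := hd')
    rw [Measure.restrict_restrict measurableSet_Icc,
      Set.inter_eq_left.2 (Set.Icc_subset_Icc h1 h3)] at h6
    exact (ENNReal.ofReal_lt_ofReal_iff hε).1 (h5.trans_lt h6)
  refine ⟨d', hd'0, fun y hy hyx => ?_⟩
  rw [Real.dist_eq] at hyx ⊢
  rcases le_total y x with h | h
  · exact key y x hy.1 h hx.2 (by rw [abs_of_nonpos (by linarith)] at hyx; linarith)
  · rw [abs_sub_comm]
    exact key x y hx.1 h hy.2 (by rw [abs_of_nonneg (by linarith)] at hyx; linarith)

lemma IsUpperGradient.trunc {X : Type*} [MetricSpace X] {w : X → ℝ} {g : X → ℝ≥0∞}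
    (hw : IsUpperGradient w g) {a b : ℝ} (hab : a ≤ b) {ε : ℝ≥0∞} (hε : ε ≠ 0) (hε' : ε ≠ ⊤) :
    IsUpperGradient (fun x => max a (min b (w x)))
      (fun x => Set.indicator {x | a < w x ∧ w x < b} g x + ε * g x) := by
  intro l γ hl hγ
  have hG : ∀ s t, 0 ≤ s → s ≤ t → t ≤ l →
      ENNReal.ofReal |w (γ s) - w (γ t)| ≤ ∫⁻ τ in Set.Icc s t, g (γ τ) :=
    fun s t hs hst ht => sub_curve hw hγ hs hst ht
  by_cases hfin : ∫⁻ τ in Set.Icc 0 l, g (γ τ) = ⊤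
  · calc _ ≤ ⊤ := le_top
      _ = ε * ∫⁻ τ in Set.Icc 0 l, g (γ τ) := by rw [hfin, ENNReal.mul_top hε]
      _ = ∫⁻ τ in Set.Icc 0 l, ε * g (γ τ) := (lintegral_const_mul' _ _ hε').symm
      _ ≤ _ := lintegral_mono fun τ => le_add_self
  · have h1 := trunc_real (w := fun t => w (γ t)) (G := fun t => g (γ t)) hl hab
      (cont_of_modulus hG hfin) hG
    refine h1.trans (lintegral_mono fun τ => ?_)
    refine le_trans (le_of_eq ?_) le_self_add
    rfl

lemma IsUpperGradient.abs_sub {X : Type*} [MetricSpace X] {w : X → ℝ} {g : X → ℝ≥0∞}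
    (hw : IsUpperGradient w g) (c : ℝ) : IsUpperGradient (fun x => |w x - c|) g := by
  intro l γ hl hγ
  refine le_trans (ENNReal.ofReal_le_ofReal ?_) (hw l γ hl hγ)
  refine (abs_abs_sub_abs_le_abs_sub _ _).trans (le_of_eq ?_)
  congr 1; ring

lemma IsUpperGradient.local {X : Type*} [MetricSpace X] {v : X → ℝ} {ρ : X → ℝ≥0∞}
    (hv : IsUpperGradient v ρ) (x : X) {r : ℝ} (hr : 0 < r) :
    IsUpperGradient (Set.indicator (ball x (2 * r)) v)
      (fun y => ρ y + Set.indicator (ball x r)ᶜ (fun _ => ⊤) y) := by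
  intro l γ hl hγ
  by_cases h : ∀ t ∈ Set.Icc 0 l, γ t ∈ ball x (2 * r)
  · rw [Set.indicator_of_mem (h 0 ⟨le_rfl, hl.le⟩), Set.indicator_of_mem (h l ⟨hl.le, le_rfl⟩)]
    exact (hv l γ hl hγ).trans (lintegral_mono fun τ => le_self_add)
  · push Not at h
    obtain ⟨t, ht, hxt⟩ := h
    refine le_trans le_top (le_of_eq ?_)
    symm
    rw [eq_top_iff]
    have hlt : max 0 (t - r) < min l (t + r) := by
      rw [lt_min_iff, max_lt_iff, max_lt_iff]
      refine ⟨⟨hl, ?_⟩, ?_, ?_⟩ <;> linarith [ht.1, ht.2]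
    calc (⊤ : ℝ≥0∞) = ∫⁻ τ in Set.Ioo (max 0 (t - r)) (min l (t + r)), ⊤ := by
          rw [lintegral_const, Measure.restrict_apply_univ, Real.volume_Ioo, ENNReal.top_mul]
          rw [Ne, ENNReal.ofReal_eq_zero]; linarith
      _ ≤ ∫⁻ τ in Set.Ioo (max 0 (t - r)) (min l (t + r)),
            (ρ (γ τ) + Set.indicator (ball x r)ᶜ (fun _ => ⊤) (γ τ)) := by
          apply setLIntegral_mono' measurableSet_Ioo
          intro τ hτ
          have h1 := hτ.1; have h2 := hτ.2
          rw [max_lt_iff] at h1; rw [lt_min_iff] at h2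
          have hmem : γ τ ∈ (ball x r)ᶜ := by
            have h3 := hγ.dist_le_mul τ ⟨h1.1.le, h2.1.le⟩ t ht
            simp only [mem_ball, not_lt, Set.mem_compl_iff] at hxt ⊢
            have h4 : dist τ t < r := by
              rw [Real.dist_eq, abs_lt]; constructor <;> linarith
            have h5 := dist_triangle_left (γ t) x (γ τ)
            simp only [NNReal.coe_one, one_mul] at h3
            linarith
          rw [Set.indicator_of_mem hmem]
          simp
      _ ≤ _ := lintegral_mono_set (Set.Ioo_subset_Icc_self.trans
          (Set.Icc_subset_Icc (le_max_left _ _) (min_le_left _ _)))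

lemma exists_cover {X : Type*} [MetricSpace X] [MeasurableSpace X] [BorelSpace X]
    (ν : Measure X) [IsFiniteMeasure ν] (A : Set X) (s : X → ℝ) (R : ℝ)
    (hs : ∀ y ∈ A, 0 < s y ∧ s y ≤ R) (hpos : ∀ y ∈ A, 0 < ν (ball y (s y))) :
    ∃ T ⊆ A, T.Countable ∧ T.PairwiseDisjoint (fun y => ball y (s y)) ∧
      A ⊆ ⋃ y ∈ T, ball y (6 * s y) := by
  obtain ⟨T, hTA, hdis, hcov⟩ := Vitali.exists_disjoint_subfamily_covering_enlargement_closedBall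
    A (fun y => y) s R (fun a ha => (hs a ha).2) 5 (by norm_num)
  have hdis' : T.PairwiseDisjoint (fun y => ball y (s y)) :=
    hdis.mono fun y => ball_subset_closedBall
  refine ⟨T, hTA, ?_, hdis', ?_⟩
  · have := Measure.countable_meas_pos_of_disjoint_iUnion (μ := ν)
      (As := fun y : T => ball (y : X) (s y)) (fun i => measurableSet_ball)
      (fun i j hij => hdis' i.2 j.2 (fun h => hij (Subtype.ext h)))
    have h2 : {i : T | 0 < ν (ball (i : X) (s i))} = Set.univ :=
      Set.eq_univ_of_forall fun i => hpos i (hTA i.2)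
    rw [h2] at this
    exact Set.countable_coe_iff.1 (Set.countable_univ_iff.1 this)
  · intro a ha
    obtain ⟨b, hb, hab⟩ := hcov a ha
    have h1 : a ∈ closedBall b (5 * s b) := hab (mem_closedBall_self (hs a ha).1.le)
    refine Set.mem_biUnion hb (closedBall_subset_ball ?_ h1)
    linarith [(hs b (hTA hb)).1]

lemma tsum_le_of_disjoint {X : Type*} [MetricSpace X] [MeasurableSpace X] [BorelSpace X]
    (ν : Measure X) {T : Set X} (hT : T.Countable) {s : X → ℝ}
    (hdis : T.PairwiseDisjoint (fun y => ball y (s y))) {U : Set X}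
    (hU : ∀ y ∈ T, ball y (s y) ⊆ U) : ∑' y : T, ν (ball (y : X) (s y)) ≤ ν U := by
  rw [← measure_biUnion hT hdis (fun y _ => measurableSet_ball)]
  exact measure_mono (Set.iUnion₂_subset hU)

noncomputable def bump {X : Type*} [MetricSpace X] (z : X) (ρ : ℝ) (x : X) : ℝ :=
  max 0 (min 1 (2 - dist x z / ρ))

section
variable {X : Type*} [MetricSpace X]

lemma bump_nonneg (z : X) (ρ : ℝ) (x : X) : 0 ≤ bump z ρ x := le_max_left _ _
lemma bump_le_one (z : X) (ρ : ℝ) (x : X) : bump z ρ x ≤ 1 :=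
  max_le zero_le_one (min_le_left _ _)
lemma bump_eq_one {z : X} {ρ : ℝ} (hρ : 0 < ρ) {x : X} (hx : x ∈ ball z ρ) : bump z ρ x = 1 := by
  have : dist x z / ρ ≤ 1 := (div_le_one hρ).2 (mem_ball.1 hx).le
  unfold bump
  rw [min_eq_left (by linarith), max_eq_right zero_le_one]
lemma bump_eq_zero {z : X} {ρ : ℝ} (hρ : 0 < ρ) {x : X} (hx : x ∉ ball z (2 * ρ)) :
    bump z ρ x = 0 := by
  have : 2 ≤ dist x z / ρ := (le_div_iff₀ hρ).2 (not_lt.1 hx)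
  unfold bump
  exact max_eq_left ((min_le_right _ _).trans (by linarith))
lemma bump_lip {z : X} {ρ : ℝ} (hρ : 0 < ρ) (x y : X) :
    |bump z ρ x - bump z ρ y| ≤ dist x y / ρ := by
  unfold bump
  refine (abs_max_sub_max_le_max _ _ _ _).trans ?_
  rw [sub_self, abs_zero]
  refine max_le (by positivity) ((abs_min_sub_min_le_max _ _ _ _).trans ?_)
  rw [sub_self, abs_zero]
  refine max_le (by positivity) ?_
  rw [show 2 - dist x z / ρ - (2 - dist y z / ρ) = (dist y z - dist x z) / ρ by ring, abs_div,
    abs_of_pos hρ]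
  gcongr
  rw [dist_comm x y]
  exact abs_dist_sub_le y x z
lemma bump_le (z : X) (ρ : ℝ) (x y : X) : |bump z ρ x - bump z ρ y| ≤ 1 := by
  rw [abs_le]
  constructor <;> linarith [bump_nonneg z ρ x, bump_nonneg z ρ y, bump_le_one z ρ x, bump_le_one z ρ y]

lemma bump_measurable [MeasurableSpace X] [BorelSpace X] (z : X) (ρ : ℝ) :
    Measurable (bump z ρ) := by
  have : Continuous (bump z ρ) := by unfold bump; fun_prop
  exact this.measurable

lemma bump_aux {z : X} {ρ l : ℝ} (hρ : 0 < ρ) (γ : ℝ → X) {t0 : ℝ} (ht0 : t0 ∈ Set.Icc 0 l)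
    (hγ : LipschitzOnWith 1 γ (Set.Icc 0 l)) (h0 : γ t0 ∈ ball z (2 * ρ)) {a b : ℝ}
    (ha : 0 ≤ a) (hb : b ≤ l) (hab : b - a = min l ρ) (hat : a ≤ t0) (htb : t0 ≤ b) :
    ENNReal.ofReal (min l ρ / ρ) ≤
    ∫⁻ t in Set.Icc 0 l, Set.indicator (ball z (3 * ρ)) (fun _ => ENNReal.ofReal ρ⁻¹) (γ t) := by
  calc ENNReal.ofReal (min l ρ / ρ) = ∫⁻ t in Set.Ioo a b, ENNReal.ofReal ρ⁻¹ := by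
        rw [lintegral_const, Measure.restrict_apply_univ, Real.volume_Ioo, hab,
          ← ENNReal.ofReal_mul (by positivity)]
        congr 1; field_simp
    _ ≤ ∫⁻ t in Set.Ioo a b,
        Set.indicator (ball z (3 * ρ)) (fun _ => ENNReal.ofReal ρ⁻¹) (γ t) := by
        apply setLIntegral_mono' measurableSet_Ioo
        intro t ht
        have h1 : t ∈ Set.Icc 0 l := ⟨ha.trans ht.1.le, ht.2.le.trans hb⟩
        have h3 := hγ.dist_le_mul t h1 t0 ht0
        simp only [NNReal.coe_one, one_mul] at h3
        have h4 : dist t t0 ≤ ρ := by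
          have := min_le_right l ρ
          rw [Real.dist_eq, abs_le]; constructor <;> linarith [ht.1, ht.2]
        have h5 : γ t ∈ ball z (3 * ρ) := by
          rw [mem_ball] at h0 ⊢
          linarith [dist_triangle (γ t) (γ t0) z]
        rw [Set.indicator_of_mem h5]
    _ ≤ _ := lintegral_mono_set (Set.Ioo_subset_Icc_self.trans (Set.Icc_subset_Icc ha hb))

lemma bump_ug (z : X) {ρ : ℝ} (hρ : 0 < ρ) :
    IsUpperGradient (bump z ρ)
      (Set.indicator (ball z (3 * ρ)) (fun _ => ENNReal.ofReal ρ⁻¹)) := by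
  intro l γ hl hγ
  have hd : |bump z ρ (γ 0) - bump z ρ (γ l)| ≤ min l ρ / ρ := by
    have h1 := bump_le z ρ (γ 0) (γ l)
    have h2 := bump_lip (z := z) hρ (γ 0) (γ l)
    have h3 := hγ.dist_le_mul 0 ⟨le_rfl, hl.le⟩ l ⟨hl.le, le_rfl⟩
    simp only [NNReal.coe_one, one_mul, Real.dist_eq, zero_sub, abs_neg, abs_of_pos hl] at h3
    rcases le_total l ρ with h | h
    · rw [min_eq_left h]
      exact h2.trans (by gcongr)
    · rwa [min_eq_right h, div_self hρ.ne']
  have hm := min_le_left l ρ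
  have hm' : 0 ≤ min l ρ := by positivity
  by_cases h0 : γ 0 ∈ ball z (2 * ρ)
  · exact (ENNReal.ofReal_le_ofReal hd).trans (bump_aux hρ γ ⟨le_rfl, hl.le⟩ hγ h0 (a := 0)
      (b := min l ρ) le_rfl hm (by ring) le_rfl hm')
  by_cases h1 : γ l ∈ ball z (2 * ρ)
  · exact (ENNReal.ofReal_le_ofReal hd).trans (bump_aux hρ γ ⟨hl.le, le_rfl⟩ hγ h1
      (a := l - min l ρ) (b := l) (by linarith) le_rfl (by ring) (by linarith) le_rfl)
  · rw [bump_eq_zero hρ h0, bump_eq_zero hρ h1]; simp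

end

lemma capacity_le {X : Type*} [MetricSpace X] [MeasurableSpace X] [BorelSpace X]
    (μ : Measure X) {q : ℝ} (hq : 0 < q) {A T : Set X} (hT : T.Countable) {ρ : X → ℝ}
    (hρ : ∀ y ∈ T, 0 < ρ y) (hA : A ⊆ ⋃ y ∈ T, ball y (ρ y)) {K : ℝ≥0∞} (hK : K < ⊤)
    (hsum : ∑' y : T, μ (ball (y : X) (3 * ρ y)) * (1 + ENNReal.ofReal (ρ y)⁻¹ ^ q) ≤ K) :
    sobolevCapacity μ q A ≤ K := by
  have : Countable T := hT.to_subtype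
  let φ : X → ℝ := fun x => ⨆ i : T, bump (i : X) (ρ i) x
  let f : T → X → ℝ≥0∞ := fun i => Set.indicator (ball (i : X) (3 * ρ i))
    (fun _ => ENNReal.ofReal (ρ i)⁻¹)
  let G : X → ℝ≥0∞ := fun x => (∑' i : T, f i x ^ q) ^ (1 / q)
  have hbdd : ∀ x, BddAbove (Set.range fun i : T => bump (i : X) (ρ i) x) := fun x =>
    ⟨1, by rintro _ ⟨i, rfl⟩; exact bump_le_one _ _ _⟩
  have hφ0 : ∀ x, 0 ≤ φ x := fun x => Real.iSup_nonneg fun i => bump_nonneg _ _ _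
  have hφ1 : ∀ x, φ x ≤ 1 := fun x => Real.iSup_le (fun i => bump_le_one _ _ _) zero_le_one
  have hfm : ∀ i, Measurable (f i) := fun i => measurable_const.indicator measurableSet_ball
  have hGm : Measurable G := by
    apply Measurable.pow_const
    exact Measurable.tsum fun i => (hfm i).pow_const _
  have hGq : ∀ x, G x ^ q = ∑' i : T, f i x ^ q := fun x => by
    simp only [G]; rw [← ENNReal.rpow_mul, one_div_mul_cancel hq.ne', ENNReal.rpow_one]
  have hfG : ∀ i x, f i x ≤ G x := fun i x => by
    have : f i x = (f i x ^ q) ^ (1 / q) := by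
      rw [← ENNReal.rpow_mul, mul_one_div_cancel hq.ne', ENNReal.rpow_one]
    rw [this]
    exact ENNReal.rpow_le_rpow (ENNReal.le_tsum i) (by positivity)
  have hφm : Measurable φ := Measurable.iSup fun i => bump_measurable _ _
  have hug : IsUpperGradient φ G := by
    intro l γ hl hγ
    by_cases hfin : ∫⁻ t in Set.Icc 0 l, G (γ t) = ⊤
    · rw [hfin]; exact le_top
    rw [ENNReal.ofReal_le_iff_le_toReal hfin]
    set J := (∫⁻ t in Set.Icc 0 l, G (γ t)).toReal with hJ
    have hJ0 : 0 ≤ J := ENNReal.toReal_nonneg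
    have hi : ∀ i : T, |bump (i : X) (ρ i) (γ 0) - bump (i : X) (ρ i) (γ l)| ≤ J := fun i => by
      rw [hJ, ← ENNReal.ofReal_le_iff_le_toReal hfin]
      exact (bump_ug (i : X) (hρ i i.2) l γ hl hγ).trans (lintegral_mono fun t => hfG i _)
    rw [abs_le]
    have e1 : φ (γ 0) ≤ φ (γ l) + J := Real.iSup_le (fun i => by
      have := (abs_le.1 (hi i)).2
      have h2 : bump (i : X) (ρ i) (γ l) ≤ φ (γ l) := le_ciSup (hbdd (γ l)) i
      linarith) (add_nonneg (hφ0 _) hJ0)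
    have e2 : φ (γ l) ≤ φ (γ 0) + J := Real.iSup_le (fun i => by
      have := (abs_le.1 (hi i)).1
      have h2 : bump (i : X) (ρ i) (γ 0) ≤ φ (γ 0) := le_ciSup (hbdd (γ 0)) i
      linarith) (add_nonneg (hφ0 _) hJ0)
    constructor <;> linarith
  have hI1 : ∫⁻ x, ENNReal.ofReal |φ x| ^ q ∂μ ≤ ∑' y : T, μ (ball (y : X) (3 * ρ y)) := by
    calc _ ≤ ∫⁻ x, ∑' i : T, Set.indicator (ball (i : X) (3 * ρ i)) (fun _ => (1 : ℝ≥0∞)) x ∂μ := by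
          apply lintegral_mono
          intro x
          beta_reduce
          rw [abs_of_nonneg (hφ0 x)]
          by_cases hx : ∃ i : T, x ∈ ball (i : X) (3 * ρ i)
          · obtain ⟨i, hi⟩ := hx
            calc ENNReal.ofReal (φ x) ^ q ≤ 1 := by
                  apply ENNReal.rpow_le_one _ hq.le
                  simpa using hφ1 x
              _ = Set.indicator (ball (i : X) (3 * ρ i)) (fun _ => (1 : ℝ≥0∞)) x := by
                  rw [Set.indicator_of_mem hi]
              _ ≤ _ := ENNReal.le_tsum (f := fun i : T =>
                Set.indicator (ball (i : X) (3 * ρ i)) (fun _ => (1 : ℝ≥0∞)) x) i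
          · push Not at hx
            have : φ x ≤ 0 := Real.iSup_le (fun i => by
              rw [bump_eq_zero (hρ i i.2)]
              intro h
              exact hx i (ball_subset_ball (by linarith [hρ i i.2]) h)) le_rfl
            simp [le_antisymm this (hφ0 x), hq]
      _ = ∑' y : T, μ (ball (y : X) (3 * ρ y)) := by
          rw [lintegral_tsum fun i => (measurable_const.indicator measurableSet_ball).aemeasurable]
          congr 1; ext i
          rw [lintegral_indicator_const measurableSet_ball, one_mul]
  have hI2 : ∫⁻ x, G x ^ q ∂μ =
      ∑' y : T, μ (ball (y : X) (3 * ρ y)) * ENNReal.ofReal (ρ y)⁻¹ ^ q := by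
    simp_rw [hGq]
    rw [lintegral_tsum fun i => ((hfm i).pow_const _).aemeasurable]
    congr 1; ext i
    have : ∀ x, f i x ^ q = Set.indicator (ball (i : X) (3 * ρ i))
        (fun _ => ENNReal.ofReal (ρ i)⁻¹ ^ q) x := fun x => by
      simp only [f]
      by_cases hx : x ∈ ball (i : X) (3 * ρ i)
      · rw [Set.indicator_of_mem hx, Set.indicator_of_mem hx]
      · rw [Set.indicator_of_notMem hx, Set.indicator_of_notMem hx]
        exact ENNReal.zero_rpow_of_pos hq
    simp_rw [this]
    rw [lintegral_indicator_const measurableSet_ball, mul_comm]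
  have htot : ∫⁻ x, ENNReal.ofReal |φ x| ^ q ∂μ + ∫⁻ x, G x ^ q ∂μ ≤ K := by
    refine le_trans (add_le_add hI1 hI2.le) ?_
    rw [← ENNReal.tsum_add]
    simpa only [mul_add, mul_one] using hsum
  unfold sobolevCapacity
  refine iInf₂_le_of_le φ ⟨⟨hφm, (le_self_add.trans htot).trans_lt hK, G, hGm, hug,
    (le_add_self.trans htot).trans_lt hK⟩, ?_⟩ ?_
  · intro x hx
    obtain ⟨y, hy, hxy⟩ := Set.mem_iUnion₂.1 (hA hx)
    rw [← bump_eq_one (hρ y hy) hxy]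
    exact le_ciSup (hbdd x) ⟨y, hy⟩
  · exact le_trans (add_le_add le_rfl (iInf₂_le G ⟨hGm, hug⟩)) htot

lemma sobolevCapacity_mono {X : Type*} [MetricSpace X] [MeasurableSpace X]
    (μ : Measure X) (q : ℝ) {A B : Set X} (h : A ⊆ B) :
    sobolevCapacity μ q A ≤ sobolevCapacity μ q B :=
  le_iInf₂ fun u hu => iInf₂_le_of_le u ⟨hu.1, fun x hx => hu.2 x (h hx)⟩ le_rfl

lemma measure_le_capacity {X : Type*} [MetricSpace X] [MeasurableSpace X]
    (μ : Measure X) {q : ℝ} (hq : 0 < q) (A : Set X) :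
    μ A ≤ sobolevCapacity μ q A := by
  refine le_iInf₂ fun u hu => le_trans ?_ le_self_add
  have hm : Measurable fun x => ENNReal.ofReal |u x| ^ q :=
    (ENNReal.measurable_ofReal.comp (measurable_norm.comp hu.1.1)).pow_const q
  have := mul_meas_ge_le_lintegral (μ := μ) hm 1
  rw [one_mul] at this
  refine (measure_mono fun x hx => ?_).trans this
  refine ENNReal.one_le_rpow ?_ hq
  rw [← ENNReal.ofReal_one]
  exact ENNReal.ofReal_le_ofReal ((hu.2 x hx).trans (le_abs_self _))

/-- Volume decay in real-valued form. -/
structure VD {X : Type*} [MetricSpace X] [MeasurableSpace X] (μ : Measure X) (C₀ Q : ℝ) : Prop where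
  C0 : 0 < C₀
  Q0 : 0 < Q
  hb : ∀ (x : X) (r : ℝ), 0 < r → 0 < μ (ball x r) ∧ μ (ball x r) < ⊤
  hd : ∀ (x y : X) (R r : ℝ), 0 < R → y ∈ ball x R → 0 < r → r ≤ R →
    C₀ * (r / R) ^ Q * μ.real (ball x R) ≤ μ.real (ball y r)

/-- Poincare inequality for the pair `(v, ν)`. -/
structure PIm {X : Type*} [MetricSpace X] [MeasurableSpace X] (μ ν : Measure X) (p σ C : ℝ)
    (v : X → ℝ) : Prop where
  int : ∀ (x : X) (r : ℝ), 0 < r → IntegrableOn v (ball x r) μ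
  pi : ∀ (x : X) (r : ℝ), 0 < r →
    ∫ y in ball x r, |v y - ⨍ z in ball x r, v z ∂μ| ∂μ ≤
      C * r * (ν.real (ball x (σ * r)) / μ.real (ball x r)) ^ (1 / p) * μ.real (ball x r)

/-- Points at which the density of `ν` with respect to `μ` does not blow up too fast. -/
def Good {X : Type*} [MetricSpace X] [MeasurableSpace X] (μ ν : Measure X) (σ q R : ℝ) (y : X) :
    Prop :=
  ∃ M : ℝ, 0 < M ∧ ∀ s, 0 < s → s ≤ R →
    ν.real (ball y (σ * s)) * s ^ q ≤ M * μ.real (ball y s)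

section
variable {X : Type*} [MetricSpace X] [MeasurableSpace X] [BorelSpace X] {μ ν : Measure X}
  {C₀ Q : ℝ}

lemma VD.pos (h : VD μ C₀ Q) (x : X) {r : ℝ} (hr : 0 < r) : 0 < μ.real (ball x r) :=
  ENNReal.toReal_pos (h.hb x r hr).1.ne' (h.hb x r hr).2.ne

lemma VD.ofReal (h : VD μ C₀ Q) (x : X) {r : ℝ} (hr : 0 < r) :
    ENNReal.ofReal (μ.real (ball x r)) = μ (ball x r) :=
  ENNReal.ofReal_toReal (h.hb x r hr).2.ne

lemma VD.upper (h : VD μ C₀ Q) {x y : X} {R r : ℝ} (hR : 0 < R) (hy : y ∈ ball x R) (hr : 0 < r)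
    (hrR : r ≤ R) : μ.real (ball x R) ≤ C₀⁻¹ * (R / r) ^ Q * μ.real (ball y r) := by
  have h1 := h.hd x y R r hR hy hr hrR
  have h2 : (r / R) ^ Q * (R / r) ^ Q = 1 := by
    rw [← Real.mul_rpow (by positivity) (by positivity)]
    rw [show r / R * (R / r) = 1 by field_simp, Real.one_rpow]
  have h3 : 0 < (R / r) ^ Q := by positivity
  calc μ.real (ball x R) = C₀⁻¹ * (R / r) ^ Q * (C₀ * (r / R) ^ Q * μ.real (ball x R)) := by
        have := h.C0
        field_simp
        linear_combination (-μ.real (ball x R)) * h2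
    _ ≤ _ := by have := h.C0; gcongr

lemma VD.scale (h : VD μ C₀ Q) (x : X) {a r : ℝ} (hr : 0 < r) (ha : 1 ≤ a) :
    μ.real (ball x (a * r)) ≤ C₀⁻¹ * a ^ Q * μ.real (ball x r) := by
  have := h.upper (x := x) (y := x) (R := a * r) (r := r) (by positivity)
    (mem_ball_self (by positivity)) hr (by nlinarith)
  rwa [mul_div_cancel_right₀ _ hr.ne'] at this

lemma bad_capacity (h : VD μ C₀ Q) [IsFiniteMeasure ν] {σ q R : ℝ} (hσ : 1 ≤ σ) (hq : 0 < q)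
    (hR : 0 < R) : sobolevCapacity μ q {y | ¬ Good μ ν σ q R y} = 0 := by
  rw [← nonpos_iff_eq_zero]
  apply ENNReal.le_of_forall_pos_le_add
  intro ε hε _
  rw [zero_add]
  have hC0 := h.C0
  set K0 := C₀⁻¹ * (18 * σ) ^ Q * (R ^ q + 1) with hK0
  have hK0p : 0 < K0 := by positivity
  have hεr : (0 : ℝ) < ε := hε
  set M := (K0 * (ν.real Set.univ + 1)) / ε with hM
  have hMp : 0 < M := by positivity
  have hbad : ∀ y ∈ {y | ¬ Good μ ν σ q R y}, ∃ s, 0 < s ∧ s ≤ R ∧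
      M * μ.real (ball y s) < ν.real (ball y (σ * s)) * s ^ q := by
    intro y hy
    by_contra hc
    push Not at hc
    exact hy ⟨M, hMp, hc⟩
  choose! s hs0 hsR hs using hbad
  have hνpos : ∀ y ∈ {y | ¬ Good μ ν σ q R y}, 0 < ν.real (ball y (σ * s y)) := by
    intro y hy
    have h1 := hs y hy
    have h2 := h.pos y (hs0 y hy)
    have h3 : 0 < s y ^ q := by have := hs0 y hy; positivity
    by_contra hc
    push Not at hc
    nlinarith [mul_pos hMp h2]
  obtain ⟨T, hTA, hTc, hdis, hcov⟩ := exists_cover ν {y | ¬ Good μ ν σ q R y}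
    (fun y => σ * s y) (σ * R) (fun y hy => ⟨by have := hs0 y hy; positivity,
      by have := hsR y hy; gcongr⟩)
    (fun y hy => by
      have := hνpos y hy
      exact (ENNReal.toReal_pos_iff.1 this).1)
  refine capacity_le μ hq hTc (ρ := fun y => 6 * (σ * s y))
    (fun y hy => by have := hs0 y (hTA hy); positivity) hcov ENNReal.coe_lt_top ?_
  have hterm : ∀ y : T, μ (ball (y : X) (3 * (6 * (σ * s y)))) *
      (1 + ENNReal.ofReal (6 * (σ * s y))⁻¹ ^ q) ≤
      ENNReal.ofReal (K0 / M) * ν (ball (y : X) (σ * s y)) := by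
    rintro ⟨y, hyT⟩
    have hy := hTA hyT
    have hsp := hs0 y hy
    have hsr := hsR y hy
    have h1 := hs y hy
    simp only
    rw [← h.ofReal y (by positivity), ENNReal.ofReal_rpow_of_nonneg (by positivity) hq.le,
      ← ENNReal.ofReal_one, ← ENNReal.ofReal_add zero_le_one (by positivity),
      ← ENNReal.ofReal_mul (by positivity),
      ← ENNReal.ofReal_toReal (measure_ne_top ν (ball y (σ * s y))),
      ← ENNReal.ofReal_mul (by positivity)]
    apply ENNReal.ofReal_le_ofReal
    change _ ≤ K0 / M * ν.real (ball y (σ * s y))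
    have h2 : μ.real (ball y (3 * (6 * (σ * s y)))) ≤
        C₀⁻¹ * (18 * σ) ^ Q * μ.real (ball y (s y)) := by
      rw [show 3 * (6 * (σ * s y)) = (18 * σ) * s y by ring]
      exact h.scale y hsp (by linarith)
    have hspq : 0 < s y ^ q := by positivity
    have h3 : 1 + ((6 * (σ * s y))⁻¹) ^ q ≤ (R ^ q + 1) * (s y ^ q)⁻¹ := by
      have e1 : 1 ≤ R ^ q * (s y ^ q)⁻¹ := by
        rw [← div_eq_mul_inv, one_le_div hspq]
        exact Real.rpow_le_rpow hsp.le hsr hq.le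
      have e2 : ((6 * (σ * s y))⁻¹) ^ q ≤ (s y ^ q)⁻¹ := by
        rw [← Real.inv_rpow hsp.le]
        apply Real.rpow_le_rpow (by positivity) _ hq.le
        apply inv_anti₀ hsp
        nlinarith
      linarith
    calc _ ≤ (C₀⁻¹ * (18 * σ) ^ Q * μ.real (ball y (s y))) * ((R ^ q + 1) * (s y ^ q)⁻¹) := by
          gcongr
      _ = K0 / M * (M * μ.real (ball y (s y))) * (s y ^ q)⁻¹ := by
          rw [hK0]; field_simp
      _ ≤ K0 / M * (ν.real (ball y (σ * s y)) * s y ^ q) * (s y ^ q)⁻¹ := by gcongr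
      _ = _ := by field_simp
  calc _ ≤ ∑' y : T, ENNReal.ofReal (K0 / M) * ν (ball (y : X) (σ * s y)) :=
        ENNReal.tsum_le_tsum hterm
    _ = ENNReal.ofReal (K0 / M) * ∑' y : T, ν (ball (y : X) (σ * s y)) := ENNReal.tsum_mul_left
    _ ≤ ENNReal.ofReal (K0 / M) * ν Set.univ := by
        gcongr
        exact tsum_le_of_disjoint ν hTc hdis fun _ _ => Set.subset_univ _
    _ ≤ ε := by
        rw [← ENNReal.ofReal_toReal (measure_ne_top ν Set.univ),
          ← ENNReal.ofReal_mul (by positivity), ← ENNReal.ofReal_coe_nnreal (p := ε)]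
        apply ENNReal.ofReal_le_ofReal
        change K0 / M * ν.real Set.univ ≤ ε
        have hn : 0 ≤ ν.real Set.univ := measureReal_nonneg
        rw [hM]
        rw [div_div_eq_mul_div, div_mul_eq_mul_div, div_le_iff₀ (by positivity)]
        have : 0 < K0 * ε := by positivity
        nlinarith

lemma avg_sub_le (h : VD μ C₀ Q) {v : X → ℝ} {z : X} {r : ℝ} (hr : 0 < r)
    (hv : IntegrableOn v (ball z r) μ) (c : ℝ) :
    |(⨍ y in ball z r, v y ∂μ) - c| * μ.real (ball z r) ≤ ∫ y in ball z r, |v y - c| ∂μ := by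
  have hp := h.pos z hr
  have hf : IsFiniteMeasure (μ.restrict (ball z r)) := ⟨by simpa using (h.hb z r hr).2⟩
  have : ((⨍ y in ball z r, v y ∂μ) - c) * μ.real (ball z r) = ∫ y in ball z r, (v y - c) ∂μ := by
    rw [integral_sub hv (integrable_const c), setAverage_eq, integral_const]
    simp only [smul_eq_mul, measureReal_restrict_apply_univ]
    field_simp
  rw [← abs_of_pos hp, ← abs_mul, this]
  exact abs_integral_le_integral_abs

lemma PIm.int_abs {p σ C : ℝ} {v : X → ℝ} (h : VD μ C₀ Q) (hv : PIm μ ν p σ C v) (x : X) {r : ℝ}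
    (hr : 0 < r) (c : ℝ) : IntegrableOn (fun y => |v y - c|) (ball x r) μ := by
  have hf : IsFiniteMeasure (μ.restrict (ball x r)) := ⟨by simpa using (h.hb x r hr).2⟩
  exact ((hv.int x r hr).sub (integrable_const c)).abs

/-- Comparison of averages over nested balls. -/
lemma PIm.comp {p σ C : ℝ} {v : X → ℝ} (h : VD μ C₀ Q) (hv : PIm μ ν p σ C v)
    {x z : X} {r s : ℝ} (hr : 0 < r) (hs : 0 < s) (hsub : ball z r ⊆ ball x s) {D : ℝ}
    (hD : μ.real (ball x s) ≤ D * μ.real (ball z r)) (hC : 0 ≤ C) :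
    |(⨍ y in ball z r, v y ∂μ) - ⨍ y in ball x s, v y ∂μ| ≤
      D * (C * s * (ν.real (ball x (σ * s)) / μ.real (ball x s)) ^ (1 / p)) := by
  have hp := h.pos z hr
  refine le_of_mul_le_mul_right ?_ hp
  calc _ ≤ ∫ y in ball z r, |v y - ⨍ y in ball x s, v y ∂μ| ∂μ := avg_sub_le h hr (hv.int z r hr) _
    _ ≤ ∫ y in ball x s, |v y - ⨍ y in ball x s, v y ∂μ| ∂μ :=
        setIntegral_mono_set (hv.int_abs h x hs _) (ae_of_all _ fun _ => abs_nonneg _)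
          (LE.le.eventuallyLE hsub)
    _ ≤ _ := hv.pi x s hs
    _ ≤ C * s * (ν.real (ball x (σ * s)) / μ.real (ball x s)) ^ (1 / p) *
        (D * μ.real (ball z r)) := by gcongr
    _ = _ := by ring

end

/-- Downward geometric telescoping. -/
lemma geom_down {a : ℝ → ℝ} {K α R : ℝ} (hα : 0 < α) (hK : 0 ≤ K)
    (h : ∀ s t, 0 < s → s ≤ t → t ≤ 2 * s → t ≤ R → |a s - a t| ≤ K * t ^ α) :
    ∀ s t, 0 < s → s ≤ t → t ≤ R → |a s - a t| ≤ K / (1 - 2 ^ (-α)) * t ^ α := by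
  have h2 : (2 : ℝ) ^ (-α) < 1 := Real.rpow_lt_one_of_one_lt_of_neg one_lt_two (by linarith)
  have h2' : (0 : ℝ) < 2 ^ (-α) := by positivity
  have hden : 0 < 1 - (2 : ℝ) ^ (-α) := by linarith
  set K' := K / (1 - 2 ^ (-α)) with hK'
  have hKK : K + K' * 2 ^ (-α) = K' := by rw [hK']; field_simp; ring
  have hK'0 : 0 ≤ K' := by positivity
  have hle : K ≤ K' := by nlinarith
  have main : ∀ n : ℕ, ∀ s t, 0 < s → s ≤ t → t ≤ R → t ≤ 2 ^ n * s → |a s - a t| ≤ K' * t ^ α := by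
    intro n
    induction n with
    | zero =>
      intro s t hs hst htR hn
      have : s = t := by simp at hn; linarith
      subst this
      rw [sub_self, abs_zero]; positivity
    | succ n ih =>
      intro s t hs hst htR hn
      have ht : 0 < t := by linarith
      rcases le_total t (2 * s) with hc | hc
      · exact (h s t hs hst hc htR).trans (by gcongr)
      · have e1 := ih s (t / 2) hs (by linarith) (by linarith) (by rw [pow_succ] at hn; linarith)
        have e2 := h (t / 2) t (by linarith) (by linarith) (by linarith) htR
        have e3 : (t / 2) ^ α = 2 ^ (-α) * t ^ α := by
          rw [Real.div_rpow ht.le zero_le_two, Real.rpow_neg zero_le_two]; field_simp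
        rw [e3] at e1
        calc _ ≤ |a s - a (t / 2)| + |a (t / 2) - a t| := abs_sub_le _ _ _
          _ ≤ K' * (2 ^ (-α) * t ^ α) + K * t ^ α := by linarith
          _ = (K + K' * 2 ^ (-α)) * t ^ α := by ring
          _ = _ := by rw [hKK]
  intro s t hs hst htR
  obtain ⟨n, hn⟩ := pow_unbounded_of_one_lt (t / s) one_lt_two
  exact main n s t hs hst htR ((div_lt_iff₀ hs).1 hn).le

/-- Upward geometric telescoping (negative exponent). -/
lemma geom_up {a : ℝ → ℝ} {K α R : ℝ} (hα : α < 0) (hK : 0 ≤ K)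
    (h : ∀ s t, 0 < s → s ≤ t → t ≤ 2 * s → t ≤ R → |a s - a t| ≤ K * t ^ α) :
    ∀ s t, 0 < s → s ≤ t → t ≤ R → |a s - a t| ≤ K / (1 - 2 ^ α) * s ^ α := by
  have h2 : (2 : ℝ) ^ α < 1 := Real.rpow_lt_one_of_one_lt_of_neg one_lt_two hα
  have h2' : (0 : ℝ) < 2 ^ α := by positivity
  have hden : 0 < 1 - (2 : ℝ) ^ α := by linarith
  set K' := K / (1 - 2 ^ α) with hK'
  have hKK : K + K' * 2 ^ α = K' := by rw [hK']; field_simp; ring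
  have hK'0 : 0 ≤ K' := by positivity
  have hle : K ≤ K' := by nlinarith
  have main : ∀ n : ℕ, ∀ s t, 0 < s → s ≤ t → t ≤ R → t ≤ 2 ^ n * s → |a s - a t| ≤ K' * s ^ α := by
    intro n
    induction n with
    | zero =>
      intro s t hs hst htR hn
      have : s = t := by simp at hn; linarith
      subst this
      rw [sub_self, abs_zero]; positivity
    | succ n ih =>
      intro s t hs hst htR hn
      have ht : 0 < t := by linarith
      have hsa : 0 < s ^ α := by positivity
      rcases le_total t (2 * s) with hc | hc
      · refine (h s t hs hst hc htR).trans ?_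
        have : t ^ α ≤ s ^ α := Real.rpow_le_rpow_of_nonpos hs hst hα.le
        gcongr
      · have e1 := ih (2 * s) t (by linarith) (by linarith) (by linarith)
          (by rw [pow_succ] at hn; linarith)
        have e2 := h s (2 * s) hs (by linarith) le_rfl (by linarith)
        rw [Real.mul_rpow zero_le_two hs.le] at e1 e2
        calc _ ≤ |a s - a (2 * s)| + |a (2 * s) - a t| := abs_sub_le _ _ _
          _ ≤ K * (2 ^ α * s ^ α) + K' * (2 ^ α * s ^ α) := by linarith
          _ ≤ K * (1 * s ^ α) + K' * (2 ^ α * s ^ α) := by gcongr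
          _ = (K + K' * 2 ^ α) * s ^ α := by ring
          _ = _ := by rw [hKK]
  intro s t hs hst htR
  obtain ⟨n, hn⟩ := pow_unbounded_of_one_lt (t / s) one_lt_two
  exact main n s t hs hst htR ((div_lt_iff₀ hs).1 hn).le

section
variable {X : Type*} [MetricSpace X] [MeasurableSpace X] [BorelSpace X] {μ ν : Measure X}
  {C₀ Q : ℝ}

lemma PIm.step {p σ C : ℝ} {v : X → ℝ} (h : VD μ C₀ Q) (hv : PIm μ ν p σ C v) (hC : 0 ≤ C)
    (x : X) {s t : ℝ} (hs : 0 < s) (hst : s ≤ t) (ht : t ≤ 2 * s) :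
    |(⨍ y in ball x s, v y ∂μ) - ⨍ y in ball x t, v y ∂μ| ≤
      C₀⁻¹ * 2 ^ Q * C * t * (ν.real (ball x (σ * t)) / μ.real (ball x t)) ^ (1 / p) := by
  have h1 := hv.comp h (x := x) (z := x) hs (hs.trans_le hst) (ball_subset_ball hst)
    (D := C₀⁻¹ * 2 ^ Q) (le_trans (measureReal_mono (ball_subset_ball ht)
      (h.hb x _ (by linarith)).2.ne) (h.scale x hs one_le_two)) hC
  linarith

lemma good_est [IsFiniteMeasure ν] {p q σ C R : ℝ} {u : X → ℝ} (h : VD μ C₀ Q)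
    (hv : PIm μ ν p σ C u)
    (hC : 0 ≤ C) (hq : 0 < q) (hqp : q < p) (hR : 0 < R) {y : X} (hy : Good μ ν σ q R y)
    (hprec : u y = limsup (fun r => ⨍ z in ball y r, u z ∂μ) (𝓝[>] (0 : ℝ))) :
    ∃ K : ℝ, 0 < K ∧ ∀ s, 0 < s → s ≤ R →
      |(⨍ z in ball y s, u z ∂μ) - u y| ≤ K * s ^ (1 - q / p) ∧
      ∫ z in ball y s, |u z - u y| ∂μ ≤ K * s ^ (1 - q / p) * μ.real (ball y s) := by
  obtain ⟨M, hM, hMs⟩ := hy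
  have hp : 0 < p := hq.trans hqp
  set α := 1 - q / p with hα
  have hα0 : 0 < α := by rw [hα, sub_pos, div_lt_one hp]; exact hqp
  have hC0 := h.C0
  set a : ℝ → ℝ := fun s => ⨍ z in ball y s, u z ∂μ with ha
  have hdens : ∀ t, 0 < t → t ≤ R →
      t * (ν.real (ball y (σ * t)) / μ.real (ball y t)) ^ (1 / p) ≤ M ^ (1 / p) * t ^ α := by
    intro t ht htR
    have h1 := hMs t ht htR
    have h2 := h.pos y ht
    have h3 : 0 < t ^ q := by positivity
    have h4 : ν.real (ball y (σ * t)) / μ.real (ball y t) ≤ M * t ^ (-q) := by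
      rw [div_le_iff₀ h2, Real.rpow_neg ht.le]
      calc _ = (ν.real (ball y (σ * t)) * t ^ q) * (t ^ q)⁻¹ := by field_simp
        _ ≤ M * μ.real (ball y t) * (t ^ q)⁻¹ := by gcongr
        _ = _ := by ring
    calc _ ≤ t * (M * t ^ (-q)) ^ (1 / p) := by
          gcongr
      _ = M ^ (1 / p) * t ^ α := by
          rw [Real.mul_rpow hM.le (by positivity), ← Real.rpow_mul ht.le]
          have : t ^ α = t ^ (1 : ℝ) * t ^ (-q * (1 / p)) := by
            rw [← Real.rpow_add ht, hα]; congr 1; ring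
          rw [this, Real.rpow_one]; ring
  set B := C₀⁻¹ * 2 ^ Q * C * M ^ (1 / p) with hB
  have hB0 : 0 ≤ B := by positivity
  have hstep : ∀ s t, 0 < s → s ≤ t → t ≤ 2 * s → t ≤ R → |a s - a t| ≤ B * t ^ α := by
    intro s t hs hst ht htR
    refine (hv.step h hC y hs hst ht).trans ?_
    have h1 := hdens t (by linarith) htR
    calc _ = C₀⁻¹ * 2 ^ Q * C * (t * (ν.real (ball y (σ * t)) / μ.real (ball y t)) ^ (1 / p)) := by
          ring
      _ ≤ C₀⁻¹ * 2 ^ Q * C * (M ^ (1 / p) * t ^ α) := by gcongr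
      _ = _ := by ring
  have hgeo := geom_down hα0 hB0 hstep
  set K' := B / (1 - 2 ^ (-α)) with hK'
  have hK'0 : 0 ≤ K' := by
    have h2 : (2 : ℝ) ^ (-α) < 1 := Real.rpow_lt_one_of_one_lt_of_neg one_lt_two (by linarith)
    have : 0 < 1 - (2 : ℝ) ^ (-α) := by linarith
    positivity
  -- convergence
  have hcau : Cauchy (map a (𝓝[>] (0 : ℝ))) := by
    rw [Metric.cauchy_iff]
    refine ⟨inferInstance, fun ε hε => ?_⟩
    have ht0 : Tendsto (fun s : ℝ => K' * s ^ α) (𝓝[>] 0) (𝓝 0) := by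
      have : ContinuousAt (fun s : ℝ => K' * s ^ α) 0 :=
        (Real.continuousAt_rpow_const _ _ (Or.inr hα0.le)).const_mul K'
      have h1 := this.tendsto.mono_left (nhdsWithin_le_nhds (s := Set.Ioi 0))
      simpa [Real.zero_rpow hα0.ne'] using h1
    have hev := (ht0.eventually (gt_mem_nhds hε)).and
      (Ioc_mem_nhdsGT hR : Set.Ioc 0 R ∈ 𝓝[>] (0 : ℝ))
    obtain ⟨t, ht1, ht2⟩ := hev.exists
    have ht1' : K' * t ^ α < ε / 1 := by simpa using ht1
    have hev2 : ∀ᶠ s in 𝓝[>] (0 : ℝ), K' * s ^ α < ε ∧ s ∈ Set.Ioc 0 R := hev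
    refine ⟨a '' {s | K' * s ^ α < ε ∧ s ∈ Set.Ioc 0 R}, image_mem_map hev2, ?_⟩
    rintro _ ⟨s, ⟨hs1, hs2⟩, rfl⟩ _ ⟨t, ⟨ht1, ht2⟩, rfl⟩
    rw [Real.dist_eq]
    rcases le_total s t with hh | hh
    · exact (hgeo s t hs2.1 hh ht2.2).trans_lt ht1
    · rw [abs_sub_comm]
      exact (hgeo t s ht2.1 hh hs2.2).trans_lt hs1
  obtain ⟨L, hL⟩ := CompleteSpace.complete hcau
  have hL' : Tendsto a (𝓝[>] (0 : ℝ)) (𝓝 L) := hL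
  have hLu : u y = L := hprec.trans hL'.limsup_eq
  have hest : ∀ s, 0 < s → s ≤ R → |a s - u y| ≤ K' * s ^ α := by
    intro s hs hsR
    have h1 : Tendsto (fun t => |a t - a s|) (𝓝[>] (0 : ℝ)) (𝓝 |L - a s|) :=
      (hL'.sub_const _).abs
    rw [abs_sub_comm, hLu]
    refine le_of_tendsto h1 ?_
    filter_upwards [(Ioc_mem_nhdsGT hs : Set.Ioc 0 s ∈ 𝓝[>] (0 : ℝ))] with t ht
    exact hgeo t s ht.1 ht.2 hsR
  refine ⟨C * M ^ (1 / p) + K' + 1, by positivity, fun s hs hsR => ⟨?_, ?_⟩⟩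
  · refine (hest s hs hsR).trans ?_
    have : 0 ≤ C * M ^ (1 / p) := by positivity
    gcongr
    linarith
  · have hf : IsFiniteMeasure (μ.restrict (ball y s)) := ⟨by simpa using (h.hb y s hs).2⟩
    have hps := h.pos y hs
    calc ∫ z in ball y s, |u z - u y| ∂μ
        ≤ ∫ z in ball y s, (|u z - a s| + |a s - u y|) ∂μ := by
          apply integral_mono (hv.int_abs h y hs _)
            ((hv.int_abs h y hs _).add (integrable_const _))
          intro z
          exact abs_sub_le _ _ _
      _ = ∫ z in ball y s, |u z - a s| ∂μ + |a s - u y| * μ.real (ball y s) := by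
          rw [integral_add (hv.int_abs h y hs _) (integrable_const _), integral_const]
          simp [mul_comm]
      _ ≤ C * (M ^ (1 / p) * s ^ α) * μ.real (ball y s) + K' * s ^ α * μ.real (ball y s) := by
          gcongr
          · refine (hv.pi y s hs).trans ?_
            rw [mul_assoc C]
            exact mul_le_mul_of_nonneg_right (mul_le_mul_of_nonneg_left (hdens s hs hsR) hC) hps.le
          · exact hest s hs hsR
      _ ≤ _ := by
          have : 0 ≤ s ^ α * μ.real (ball y s) := by positivity
          nlinarith

lemma hedberg {p σ C : ℝ} (hC : 0 ≤ C) (hp : 1 < p) (hpQ : p < Q) (hC₀ : 0 < C₀) :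
    ∃ Kc : ℝ, 0 < Kc ∧ ∀ (μ ν : Measure X) (v : X → ℝ) (_ : VD μ C₀ Q) (_ : PIm μ ν p σ C v)
      (y : X) (r lam κ L : ℝ), 0 < r → 0 < lam → 0 < κ →
      (∀ s, 0 < s → s ≤ 2 * r → ν.real (ball y (σ * s)) ≤ lam * μ.real (ball y s)) →
      (∀ s, 0 < s → s ≤ 2 * r →
        ν.real (ball y (σ * s)) ≤ κ * (r / s) ^ Q * μ.real (ball y s)) →
      Tendsto (fun s => ⨍ z in ball y s, v z ∂μ) (𝓝[>] (0 : ℝ)) (𝓝 L) →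
      |L - ⨍ z in ball y (2 * r), v z ∂μ| ≤ Kc * r * lam ^ (1 / p - 1 / Q) * κ ^ (1 / Q) := by
  have hp0 : 0 < p := by linarith
  have hQ0 : 0 < Q := by linarith
  set B := C₀⁻¹ * 2 ^ Q * C with hB
  have hB0 : 0 ≤ B := by positivity
  set β := 1 - Q / p with hβ
  have hβ0 : β < 0 := by rw [hβ, sub_neg, one_lt_div hp0]; exact hpQ
  have h2β : (2 : ℝ) ^ β < 1 := Real.rpow_lt_one_of_one_lt_of_neg one_lt_two hβ0
  have h2β' : 0 < 1 - (2 : ℝ) ^ β := by linarith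
  have h21 : 0 < 1 - (2 : ℝ) ^ (-1 : ℝ) := by
    rw [Real.rpow_neg zero_le_two, Real.rpow_one]; norm_num
  set K1 := B / (1 - 2 ^ (-1 : ℝ)) with hK1
  set K2 := B / (1 - 2 ^ β) with hK2
  have hK10 : 0 ≤ K1 := by positivity
  have hK20 : 0 ≤ K2 := by positivity
  refine ⟨K1 + K2 + 1, by positivity, ?_⟩
  intro μ ν v h hv y r lam κ L hr hlam hκ hl hk hL
  set a : ℝ → ℝ := fun s => ⨍ z in ball y s, v z ∂μ with ha
  have hd : ∀ s t, 0 < s → s ≤ t → t ≤ 2 * r → |a s - a t| ≤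
      K1 * lam ^ (1 / p) * t := by
    have := geom_down (a := a) (K := B * lam ^ (1 / p)) (α := 1) (R := 2 * r) one_pos
      (by positivity) (by
        intro s t hs hst ht htr
        have ht0 : 0 < t := by linarith
        refine (hv.step h hC y hs hst ht).trans ?_
        rw [Real.rpow_one]
        calc _ ≤ B * t * lam ^ (1 / p) := by
              gcongr
              exact (div_le_iff₀ (h.pos y ht0)).2 (hl t ht0 htr)
          _ = _ := by ring)
    intro s t hs hst ht
    refine (this s t hs hst ht).trans (le_of_eq ?_)
    rw [Real.rpow_one, hK1]; ring
  have hu : ∀ s t, 0 < s → s ≤ t → t ≤ 2 * r → |a s - a t| ≤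
      K2 * κ ^ (1 / p) * r ^ (Q / p) * s ^ β := by
    have := geom_up (a := a) (K := B * κ ^ (1 / p) * r ^ (Q / p)) (α := β) (R := 2 * r) hβ0
      (by positivity) (by
        intro s t hs hst ht htr
        have ht0 : 0 < t := by linarith
        refine (hv.step h hC y hs hst ht).trans ?_
        calc _ ≤ B * t * (κ * (r / t) ^ Q) ^ (1 / p) := by
              gcongr
              exact (div_le_iff₀ (h.pos y ht0)).2 (hk t ht0 htr)
          _ = _ := by
              rw [Real.mul_rpow hκ.le (by positivity), ← Real.rpow_mul (by positivity),
                Real.div_rpow hr.le ht0.le, mul_one_div, hβ, Real.rpow_sub ht0, Real.rpow_one]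
              ring)
    intro s t hs hst ht
    refine (this s t hs hst ht).trans (le_of_eq ?_)
    rw [hK2]; ring
  have hlim : ∀ t, 0 < t → t ≤ 2 * r → |L - a t| ≤ K1 * lam ^ (1 / p) * t := by
    intro t ht htr
    have h1 : Tendsto (fun s => |a s - a t|) (𝓝[>] (0 : ℝ)) (𝓝 |L - a t|) :=
      (hL.sub_const _).abs
    refine le_of_tendsto h1 ?_
    filter_upwards [(Ioc_mem_nhdsGT ht : Set.Ioc 0 t ∈ 𝓝[>] (0 : ℝ))] with s hs
    exact hd s t hs.1 hs.2 htr
  set s0 := r * (κ / lam) ^ (1 / Q) with hs0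
  have hs0p : 0 < s0 := by positivity
  have e1 : lam ^ (1 / p) * s0 = r * lam ^ (1 / p - 1 / Q) * κ ^ (1 / Q) := by
    rw [hs0, Real.div_rpow hκ.le hlam.le, Real.rpow_sub hlam]; ring
  have e2 : κ ^ (1 / p) * r ^ (Q / p) * s0 ^ β = r * lam ^ (1 / p - 1 / Q) * κ ^ (1 / Q) := by
    rw [hs0, Real.mul_rpow hr.le (by positivity), ← Real.rpow_mul (by positivity),
      Real.div_rpow hκ.le hlam.le]
    have f1 : r ^ (Q / p) * r ^ β = r := by
      rw [← Real.rpow_add hr, hβ, add_sub_cancel, Real.rpow_one]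
    have f2 : 1 / Q * β = 1 / Q - 1 / p := by rw [hβ]; field_simp
    have f3 : κ ^ (1 / p) * κ ^ (1 / Q - 1 / p) = κ ^ (1 / Q) := by
      rw [← Real.rpow_add hκ]; congr 1; ring
    have f4 : lam ^ (1 / p - 1 / Q) = (lam ^ (1 / Q - 1 / p))⁻¹ := by
      rw [← Real.rpow_neg hlam.le]; congr 1; ring
    rw [f2, f4]
    calc _ = (r ^ (Q / p) * r ^ β) * (κ ^ (1 / p) * κ ^ (1 / Q - 1 / p)) *
          (lam ^ (1 / Q - 1 / p))⁻¹ := by ring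
      _ = _ := by rw [f1, f3]; ring
  set W := r * lam ^ (1 / p - 1 / Q) * κ ^ (1 / Q) with hW
  have hW0 : 0 ≤ W := by positivity
  have goal : |L - a (2 * r)| ≤ (K1 + K2) * W := by
    rcases le_total s0 (2 * r) with hc | hc
    · calc _ ≤ |L - a s0| + |a s0 - a (2 * r)| := abs_sub_le _ _ _
        _ ≤ K1 * lam ^ (1 / p) * s0 + K2 * κ ^ (1 / p) * r ^ (Q / p) * s0 ^ β :=
            add_le_add (hlim s0 hs0p hc) (hu s0 (2 * r) hs0p hc le_rfl)
        _ = K1 * (lam ^ (1 / p) * s0) + K2 * (κ ^ (1 / p) * r ^ (Q / p) * s0 ^ β) := by ring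
        _ = _ := by rw [e1, e2]; ring
    · calc _ ≤ K1 * lam ^ (1 / p) * (2 * r) := hlim _ (by positivity) le_rfl
        _ ≤ K1 * lam ^ (1 / p) * s0 := by gcongr
        _ = K1 * W := by rw [mul_assoc, e1]
        _ ≤ _ := by nlinarith
  calc _ ≤ (K1 + K2) * W := goal
    _ ≤ (K1 + K2 + 1) * W := by nlinarith
    _ = _ := by rw [hW]; ring

lemma pim_of_pi (h : VD μ C₀ Q) {p σ C_P : ℝ} (hp : 1 < p) (hC : 0 < C_P) (hσ : 1 ≤ σ)
    (hPI : ∀ (x : X) (r : ℝ), 0 < r →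
      ∀ (v : X → ℝ) (ρ : X → ℝ≥0∞), Integrable v μ → Measurable ρ → IsUpperGradient v ρ →
        ⨍⁻ y in ball x r, ENNReal.ofReal |v y - ⨍ z in ball x r, v z ∂μ| ∂μ ≤
          ENNReal.ofReal (C_P * Metric.diam (ball x r)) *
            (⨍⁻ y in ball x (σ * r), ρ y ^ p ∂μ) ^ (1 / p))
    {v : X → ℝ} {ρ : X → ℝ≥0∞} (hintg : ∀ (x : X) (r : ℝ), 0 < r → IntegrableOn v (ball x r) μ)
    (hρm : Measurable ρ) (hug : IsUpperGradient v ρ) (hfin : ∫⁻ x, ρ x ^ p ∂μ < ⊤) :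
    PIm μ (μ.withDensity fun x => ρ x ^ p) p σ (2 * C_P) v := by
  refine ⟨hintg, fun x r hr => ?_⟩
  have hp0 : 0 < p := by linarith
  have hσr : 0 < σ * r := by positivity
  set ν := μ.withDensity fun x => ρ x ^ p with hν
  have hνfin : IsFiniteMeasure ν := ⟨by
    rw [hν, withDensity_apply _ MeasurableSet.univ]; simpa using hfin⟩
  have hf : IsFiniteMeasure (μ.restrict (ball x r)) := ⟨by simpa using (h.hb x r hr).2⟩
  set v' := Set.indicator (ball x (2 * (σ * r))) v with hv'
  set ρ' : X → ℝ≥0∞ := fun y => ρ y + Set.indicator (ball x (σ * r))ᶜ (fun _ => ⊤) y with hρ'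
  have hsub : ball x r ⊆ ball x (2 * (σ * r)) := ball_subset_ball (by nlinarith)
  have hvv : ∀ y ∈ ball x r, v' y = v y := fun y hy => Set.indicator_of_mem (hsub hy) v
  have h1 := hPI x r hr v' ρ' ((integrable_indicator_iff measurableSet_ball).2
    (hintg x _ (by positivity))) (hρm.add (measurable_const.indicator measurableSet_ball.compl))
    (hug.local x hσr)
  have havg : ⨍ z in ball x r, v' z ∂μ = ⨍ z in ball x r, v z ∂μ := by
    rw [setAverage_eq, setAverage_eq, setIntegral_congr_fun measurableSet_ball hvv]
  rw [havg] at h1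
  set c := ⨍ z in ball x r, v z ∂μ with hc
  have hi : IntegrableOn (fun y => |v y - c|) (ball x r) μ :=
    ((hintg x r hr).sub (integrable_const c)).abs
  have hL : ⨍⁻ y in ball x r, ENNReal.ofReal |v' y - c| ∂μ =
      ENNReal.ofReal (∫ y in ball x r, |v y - c| ∂μ) / μ (ball x r) := by
    rw [setLAverage_eq, ofReal_integral_eq_lintegral_ofReal hi (ae_of_all _ fun _ => abs_nonneg _)]
    congr 1
    exact setLIntegral_congr_fun measurableSet_ball fun y hy => by simp only [hvv y hy]
  have hRi : ⨍⁻ y in ball x (σ * r), ρ' y ^ p ∂μ = ν (ball x (σ * r)) / μ (ball x (σ * r)) := by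
    rw [setLAverage_eq, hν, withDensity_apply _ measurableSet_ball]
    congr 1
    refine setLIntegral_congr_fun measurableSet_ball fun y hy => ?_
    simp only [hρ']
    rw [Set.indicator_of_notMem (by simpa using hy), add_zero]
  rw [hL, hRi] at h1
  have hdiam : Metric.diam (ball x r) ≤ 2 * r := Metric.diam_ball hr.le
  have hμ0 := (h.hb x r hr).1.ne'
  have hμt := (h.hb x r hr).2.ne
  have hpos := h.pos x hr
  have h2 : ENNReal.ofReal (∫ y in ball x r, |v y - c| ∂μ) ≤
      ENNReal.ofReal (2 * C_P * r * (ν.real (ball x (σ * r)) / μ.real (ball x r)) ^ (1 / p) *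
        μ.real (ball x r)) := by
    rw [ENNReal.div_le_iff hμ0 hμt] at h1
    refine h1.trans ?_
    have hnn : 0 ≤ 2 * C_P * r := by positivity
    rw [ENNReal.ofReal_mul (q := μ.real (ball x r)) (by positivity), ENNReal.ofReal_mul hnn,
      h.ofReal x hr,
      ← ENNReal.ofReal_rpow_of_nonneg (by positivity) (by positivity),
      ENNReal.ofReal_div_of_pos hpos, h.ofReal x hr]
    unfold Measure.real
    rw [ENNReal.ofReal_toReal (measure_ne_top ν _)]
    have hd2 : C_P * Metric.diam (ball x r) ≤ 2 * C_P * r := by nlinarith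
    have hb2 : μ (ball x r) ≤ μ (ball x (σ * r)) := measure_mono (ball_subset_ball (by nlinarith))
    exact mul_le_mul' (mul_le_mul' (ENNReal.ofReal_le_ofReal hd2)
      (ENNReal.rpow_le_rpow (ENNReal.div_le_div_left hb2 _) (by positivity))) le_rfl
  exact (ENNReal.ofReal_le_ofReal_iff (by positivity)).1 h2

end

section
variable {X : Type*} [MetricSpace X] [MeasurableSpace X] [BorelSpace X] {C₀ Q : ℝ}

lemma weak_level {p σ C : ℝ} (hC : 0 ≤ C) (hp : 1 < p) (hpQ : p < Q) (hC₀ : 0 < C₀)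
    (hσ : 1 ≤ σ) :
    ∃ K5 : ℝ, 0 < K5 ∧ ∀ (μ ν : Measure X) (v : X → ℝ) (_ : VD μ C₀ Q) (_ : PIm μ ν p σ C v)
      (_ : IsFiniteMeasure ν) (x : X) (r κ t : ℝ) (A : Set X), 0 < r → 0 < κ → 0 < t →
      ν.real (ball x (3 * σ * r)) ≤ κ * μ.real (ball x r) → A ⊆ ball x r →
      (∀ y ∈ A, ∃ L, Tendsto (fun s => ⨍ z in ball y s, v z ∂μ) (𝓝[>] (0 : ℝ)) (𝓝 L) ∧
        t / 4 < |L - ⨍ z in ball y (2 * r), v z ∂μ|) →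
      μ A ≤ ENNReal.ofReal (K5 * (r / t) ^ (1 / (1 / p - 1 / Q)) *
        κ ^ (1 / Q * (1 / (1 / p - 1 / Q))) * κ * μ.real (ball x r)) := by
  obtain ⟨Kc, hKc, hed⟩ := hedberg (X := X) (p := p) (σ := σ) (C := C) hC hp hpQ hC₀
  have hp0 : 0 < p := by linarith
  have hQ0 : 0 < Q := by linarith
  set e := 1 / p - 1 / Q with he
  have he0 : 0 < e := by
    rw [he]; have := one_div_lt_one_div_of_lt hp0 hpQ; linarith
  have hσ0 : 0 < σ := by linarith
  refine ⟨C₀⁻¹ * (6 * σ) ^ Q * (4 * Kc) ^ (1 / e) * (C₀⁻¹ * 2 ^ Q) ^ (1 / Q * (1 / e)),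
    by positivity, ?_⟩
  intro μ ν v h hv hfin x r κ t A hr hκ ht hνκ hA hy
  set κ' := C₀⁻¹ * 2 ^ Q * κ with hκ'
  have hκ'0 : 0 < κ' := by positivity
  set lam := (t / (4 * Kc * r * κ' ^ (1 / Q))) ^ (1 / e) with hlam
  have hlam0 : 0 < lam := by positivity
  have hball : ∀ y ∈ A, ∀ s, s ≤ 2 * r → ball y (σ * s) ⊆ ball x (3 * σ * r) := by
    intro y hyA s hs
    refine ball_subset_ball' ?_
    have := mem_ball.1 (hA hyA)
    nlinarith
  have hex : ∀ y ∈ A, ∃ s, 0 < s ∧ s ≤ 2 * r ∧ lam * μ.real (ball y s) < ν.real (ball y (σ * s)) := by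
    intro y hyA
    by_contra hcon
    push Not at hcon
    obtain ⟨L, hL, hLt⟩ := hy y hyA
    have hmem := mem_ball.1 (hA hyA)
    have := hed μ ν v h hv y r lam κ' L hr hlam0 hκ'0 (fun s hs hs2 => hcon s hs hs2) (fun s hs hs2 => by
      calc ν.real (ball y (σ * s)) ≤ ν.real (ball x (3 * σ * r)) :=
            measureReal_mono (hball y hyA s hs2)
        _ ≤ κ * μ.real (ball x r) := hνκ
        _ ≤ κ * μ.real (ball y (2 * r)) := by
            have hsub : ball x r ⊆ ball y (2 * r) :=
              ball_subset_ball' (by rw [dist_comm]; linarith)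
            have := measureReal_mono hsub (h.hb y (2 * r) (by positivity)).2.ne
            gcongr
        _ ≤ κ * (C₀⁻¹ * (2 * r / s) ^ Q * μ.real (ball y s)) := by
            gcongr
            exact h.upper (by positivity) (mem_ball_self (by positivity)) hs hs2
        _ = _ := by
            rw [hκ', mul_div_assoc, Real.mul_rpow (by norm_num) (by positivity)]; ring) hL
    have e1 : lam ^ e = t / (4 * Kc * r * κ' ^ (1 / Q)) := by
      rw [hlam, ← Real.rpow_mul (by positivity), one_div_mul_cancel he0.ne', Real.rpow_one]
    rw [e1] at this
    have e2 : Kc * r * (t / (4 * Kc * r * κ' ^ (1 / Q))) * κ' ^ (1 / Q) = t / 4 := by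
      field_simp
    rw [e2] at this
    linarith
  choose! s hs0 hs2 hs using hex
  obtain ⟨T, hTA, hTc, hdis, hcov⟩ := exists_cover ν A (fun y => σ * s y) (σ * (2 * r))
    (fun y hyA => ⟨by have := hs0 y hyA; positivity, by have := hs2 y hyA; gcongr⟩)
    (fun y hyA => by
      have h1 := hs y hyA
      have h2 := h.pos y (hs0 y hyA)
      have h3 : 0 < ν.real (ball y (σ * s y)) := lt_trans (by positivity) h1
      exact (ENNReal.toReal_pos_iff.1 h3).1)
  have hD : ∀ y ∈ A, μ (ball y (6 * (σ * s y))) ≤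
      ENNReal.ofReal (C₀⁻¹ * (6 * σ) ^ Q * lam⁻¹) * ν (ball y (σ * s y)) := by
    intro y hyA
    have hs0' := hs0 y hyA
    rw [← mul_assoc, ← h.ofReal y (by positivity), ← ENNReal.ofReal_toReal (measure_ne_top ν (ball y (σ * s y))),
      ← ENNReal.ofReal_mul (by positivity)]
    refine ENNReal.ofReal_le_ofReal ?_
    calc _ ≤ C₀⁻¹ * (6 * σ) ^ Q * μ.real (ball y (s y)) := h.scale y hs0' (by linarith)
      _ = C₀⁻¹ * (6 * σ) ^ Q * lam⁻¹ * (lam * μ.real (ball y (s y))) := by field_simp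
      _ ≤ C₀⁻¹ * (6 * σ) ^ Q * lam⁻¹ * ν.real (ball y (σ * s y)) := by
          have := hs y hyA
          gcongr
  have : Countable T := hTc.to_subtype
  calc μ A ≤ μ (⋃ y ∈ T, ball y (6 * (σ * s y))) := measure_mono hcov
    _ ≤ ∑' y : T, μ (ball (y : X) (6 * (σ * s y))) := measure_biUnion_le μ hTc _
    _ ≤ ∑' y : T, ENNReal.ofReal (C₀⁻¹ * (6 * σ) ^ Q * lam⁻¹) * ν (ball (y : X) (σ * s y)) :=
        ENNReal.tsum_le_tsum fun y => hD y (hTA y.2)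
    _ ≤ ENNReal.ofReal (C₀⁻¹ * (6 * σ) ^ Q * lam⁻¹) * ν (ball x (3 * σ * r)) := by
        rw [ENNReal.tsum_mul_left]
        gcongr
        exact tsum_le_of_disjoint ν hTc hdis fun y hyT => hball y (hTA hyT) _ (hs2 y (hTA hyT))
    _ ≤ ENNReal.ofReal (C₀⁻¹ * (6 * σ) ^ Q * lam⁻¹ * (κ * μ.real (ball x r))) := by
        rw [ENNReal.ofReal_mul (q := κ * μ.real (ball x r)) (by positivity)]
        refine mul_le_mul' le_rfl ?_
        rw [← ENNReal.ofReal_toReal (measure_ne_top ν (ball x (3 * σ * r)))]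
        exact ENNReal.ofReal_le_ofReal hνκ
    _ = _ := by
        congr 1
        have : lam⁻¹ = (4 * Kc) ^ (1 / e) * (r / t) ^ (1 / e) *
            ((C₀⁻¹ * 2 ^ Q) ^ (1 / Q * (1 / e)) * κ ^ (1 / Q * (1 / e))) := by
          rw [hlam, ← Real.inv_rpow (by positivity), inv_div,
            ← Real.mul_rpow (by positivity) (by positivity), ← Real.mul_rpow (by positivity) (by positivity),
            ← hκ', Real.rpow_mul hκ'0.le, ← Real.mul_rpow (by positivity) (by positivity)]
          congr 1; ring
        rw [this]; ring

end

section
variable {X : Type*}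

/-- Upper gradient of the truncation at levels `2^k T`, `2^(k+1) T`. -/
noncomputable def rhok (w : X → ℝ) (g : X → ℝ≥0∞) (T : ℝ) (k : ℕ) (x : X) : ℝ≥0∞ :=
  Set.indicator {x | 2 ^ k * T < w x ∧ w x < 2 ^ (k + 1) * T} g x + (2⁻¹ : ℝ≥0∞) ^ k * g x

lemma rhok_pow_le {w : X → ℝ} {g : X → ℝ≥0∞} {T p : ℝ} (hp : 1 < p) (k : ℕ) (x : X) :
    rhok w g T k x ^ p ≤ (2 : ℝ≥0∞) ^ p *
      (Set.indicator {x | 2 ^ k * T < w x ∧ w x < 2 ^ (k + 1) * T} (fun x => g x ^ p) x +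
        (2⁻¹ : ℝ≥0∞) ^ k * g x ^ p) := by
  have hp0 : 0 < p := by linarith
  have key : ∀ a b : ℝ≥0∞, (a + b) ^ p ≤ 2 ^ p * (a ^ p + b ^ p) := by
    intro a b
    rcases le_total a b with hab | hab
    · calc (a + b) ^ p ≤ (2 * b) ^ p := by
            refine ENNReal.rpow_le_rpow ?_ hp0.le
            rw [two_mul]; gcongr
        _ = 2 ^ p * b ^ p := ENNReal.mul_rpow_of_nonneg _ _ hp0.le
        _ ≤ _ := by gcongr; exact le_add_self
    · calc (a + b) ^ p ≤ (2 * a) ^ p := by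
            refine ENNReal.rpow_le_rpow ?_ hp0.le
            rw [two_mul]; gcongr
        _ = 2 ^ p * a ^ p := ENNReal.mul_rpow_of_nonneg _ _ hp0.le
        _ ≤ _ := by gcongr; exact le_self_add
  refine (key _ _).trans ?_
  refine mul_le_mul' le_rfl (add_le_add (le_of_eq ?_) ?_)
  · by_cases hx : x ∈ {x | 2 ^ k * T < w x ∧ w x < 2 ^ (k + 1) * T}
    · rw [Set.indicator_of_mem hx, Set.indicator_of_mem hx]
    · rw [Set.indicator_of_notMem hx, Set.indicator_of_notMem hx, ENNReal.zero_rpow_of_pos hp0]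
  · rw [ENNReal.mul_rpow_of_nonneg _ _ hp0.le]
    refine mul_le_mul' ?_ le_rfl
    have h1 : ((2⁻¹ : ℝ≥0∞) ^ k) ≤ 1 := pow_le_one' (by norm_num) k
    calc ((2⁻¹ : ℝ≥0∞) ^ k) ^ p ≤ ((2⁻¹ : ℝ≥0∞) ^ k) ^ (1 : ℝ) :=
          ENNReal.rpow_le_rpow_of_exponent_ge h1 hp.le
      _ = _ := ENNReal.rpow_one _

lemma rhok_sum {w : X → ℝ} {g : X → ℝ≥0∞} {T p : ℝ} (hp : 1 < p) (hT : 0 < T) (x : X) :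
    ∑' k, rhok w g T k x ^ p ≤ (2 : ℝ≥0∞) ^ p * 3 * g x ^ p := by
  refine (ENNReal.tsum_le_tsum fun k => rhok_pow_le hp k x).trans ?_
  rw [ENNReal.tsum_mul_left, mul_assoc]
  refine mul_le_mul' le_rfl ?_
  rw [ENNReal.tsum_add, ENNReal.tsum_mul_right, ENNReal.tsum_geometric]
  have h2 : (1 - 2⁻¹ : ℝ≥0∞)⁻¹ = 2 := by
    rw [ENNReal.one_sub_inv_two, inv_inv]
  rw [h2, show (3 : ℝ≥0∞) = 1 + 2 by norm_num, add_mul, one_mul]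
  refine add_le_add ?_ le_rfl
  by_cases hx : ∃ k : ℕ, 2 ^ k * T < w x ∧ w x < 2 ^ (k + 1) * T
  · obtain ⟨k, hk⟩ := hx
    rw [tsum_eq_single k]
    · exact Set.indicator_le_self _ _ _
    · intro j hj
      refine Set.indicator_of_notMem ?_ _
      rintro ⟨h1, h2⟩
      rcases lt_or_gt_of_ne hj with h | h
      · have : (2 : ℝ) ^ (j + 1) ≤ 2 ^ k := pow_le_pow_right₀ one_le_two h
        nlinarith [hk.1]
      · have : (2 : ℝ) ^ (k + 1) ≤ 2 ^ j := pow_le_pow_right₀ one_le_two h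
        nlinarith [hk.2]
  · push Not at hx
    have : ∀ k : ℕ, Set.indicator {x | 2 ^ k * T < w x ∧ w x < 2 ^ (k + 1) * T}
        (fun x => g x ^ p) x = 0 := by
      intro k
      refine Set.indicator_of_notMem ?_ _
      rintro ⟨h1, h2⟩
      linarith [hx k h1]
    simp only [this, tsum_zero, zero_le]

variable [MeasurableSpace X]

lemma rhok_meas {w : X → ℝ} {g : X → ℝ≥0∞} {T : ℝ} (hw : Measurable w) (hg : Measurable g) (k : ℕ) :
    Measurable (rhok w g T k) := by
  unfold rhok
  exact (hg.indicator ((measurableSet_lt measurable_const hw).inter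
    (measurableSet_lt hw measurable_const))).add (hg.const_mul _)

lemma nuk_sum (μ : Measure X) {w : X → ℝ} {g : X → ℝ≥0∞} {T p : ℝ} (hp : 1 < p) (hT : 0 < T)
    (hw : Measurable w) (hg : Measurable g) {U : Set X} (hU : MeasurableSet U) :
    ∑' k, (μ.withDensity fun x => rhok w g T k x ^ p) U ≤
      (2 : ℝ≥0∞) ^ p * 3 * (μ.withDensity fun x => g x ^ p) U := by
  simp only [withDensity_apply _ hU]
  rw [← lintegral_tsum fun k => ((rhok_meas hw hg k).pow_const p).aemeasurable,
    ← lintegral_const_mul _ (hg.pow_const p)]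
  exact lintegral_mono fun x => rhok_sum hp hT x

end

lemma trunc_lip (a b s t : ℝ) : |max a (min b s) - max a (min b t)| ≤ |s - t| := by
  have h1 := abs_max_sub_max_le_max a (min b s) a (min b t)
  have h2 := abs_min_sub_min_le_max b s b t
  rw [sub_self, abs_zero] at h1 h2
  exact h1.trans (max_le (abs_nonneg _) (h2.trans (max_le (abs_nonneg _) le_rfl)))

lemma level_sum {w T H : ℝ} (hT : 0 < T) (hH : 0 < H) :
    ENNReal.ofReal w ^ H ≤ ENNReal.ofReal ((2 * T) ^ H) +
      ∑' k : ℕ, Set.indicator {z : ℝ | 2 ^ (k + 1) * T ≤ z}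
        (fun _ => ENNReal.ofReal ((2 ^ (k + 2) * T) ^ H)) w := by
  rcases le_or_gt w (2 * T) with hw | hw
  · refine le_trans ?_ le_self_add
    rw [← ENNReal.ofReal_rpow_of_nonneg (by positivity) hH.le]
    exact ENNReal.rpow_le_rpow (ENNReal.ofReal_le_ofReal hw) hH.le
  · refine le_trans ?_ le_add_self
    obtain ⟨k, hk1, hk2⟩ := exists_nat_pow_near (x := w / (2 * T)) (y := 2)
      (by rw [le_div_iff₀ (by positivity)]; linarith) one_lt_two
    rw [le_div_iff₀ (by positivity)] at hk1
    rw [div_lt_iff₀ (by positivity)] at hk2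
    refine le_trans ?_ (ENNReal.le_tsum k)
    rw [Set.indicator_of_mem (by
      change 2 ^ (k + 1) * T ≤ w
      rw [pow_succ]; linarith)]
    rw [← ENNReal.ofReal_rpow_of_nonneg (by positivity) hH.le]
    refine ENNReal.rpow_le_rpow (ENNReal.ofReal_le_ofReal ?_) hH.le
    have : (2 : ℝ) ^ (k + 2) * T = 2 ^ (k + 1) * (2 * T) := by ring
    linarith

section
variable {X : Type*} [MetricSpace X] [MeasurableSpace X] [BorelSpace X] {C₀ Q : ℝ}
  {μ : Measure X}

/-- Strong Lebesgue point, in the form used below. -/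
def LebPt (μ : Measure X) (u : X → ℝ) (y : X) : Prop :=
  ∃ φ : ℝ → ℝ, Tendsto φ (𝓝[>] 0) (𝓝 0) ∧ ∀ᶠ s in 𝓝[>] 0,
    ∫ z in ball y s, |u z - u y| ∂μ ≤ φ s * μ.real (ball y s)

lemma trunc_int (h : VD μ C₀ Q) {w : X → ℝ} (hw : Measurable w) {a b : ℝ} (ha : 0 ≤ a)
    (hab : a ≤ b) (y : X) {r : ℝ} (hr : 0 < r) :
    IntegrableOn (fun z => max a (min b (w z))) (ball y r) μ := by
  refine Measure.integrableOn_of_bounded (M := b) (h.hb y r hr).2.ne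
    (measurable_const.max (measurable_const.min hw)).aestronglyMeasurable (ae_of_all _ fun z => ?_)
  rw [Real.norm_of_nonneg (le_max_of_le_left ha)]
  exact max_le hab (min_le_left _ _)

lemma LebPt.trunc (h : VD μ C₀ Q) {u : X → ℝ} (hu : Measurable u)
    (hintg : ∀ (x : X) (r : ℝ), 0 < r → IntegrableOn u (ball x r) μ) {y : X} (hy : LebPt μ u y)
    (c : ℝ) {a b : ℝ} (ha : 0 ≤ a) (hab : a ≤ b) :
    Tendsto (fun s => ⨍ z in ball y s, max a (min b |u z - c|) ∂μ) (𝓝[>] (0 : ℝ))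
      (𝓝 (max a (min b |u y - c|))) := by
  obtain ⟨φ, hφ, hev⟩ := hy
  rw [tendsto_iff_dist_tendsto_zero]
  refine squeeze_zero' (Eventually.of_forall fun _ => dist_nonneg) ?_ hφ
  filter_upwards [hev, self_mem_nhdsWithin] with s hs hs0
  have hs0' : 0 < s := hs0
  have hw : Measurable fun z => |u z - c| := (hu.sub_const c).abs
  have hf : IsFiniteMeasure (μ.restrict (ball y s)) := ⟨by simpa using (h.hb y s hs0').2⟩
  have hi := trunc_int h hw ha hab y hs0'
  rw [Real.dist_eq]
  refine le_of_mul_le_mul_right ?_ (h.pos y hs0')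
  refine (avg_sub_le h hs0' hi _).trans (le_trans ?_ hs)
  refine integral_mono (hi.sub (integrable_const _)).abs
    ((hintg y s hs0').sub (integrable_const _)).abs fun z => ?_
  refine (trunc_lip _ _ _ _).trans ((abs_abs_sub_abs_le_abs_sub _ _).trans (le_of_eq ?_))
  congr 1; ring

/-- Level set estimate on one ball. -/
lemma level_gap {ν : Measure X} [IsFiniteMeasure ν] {p σ C : ℝ} (h : VD μ C₀ Q) (hp : 1 < p)
    (hC : 0 < C)
    {u : X → ℝ} (hu : Measurable u) (hv : PIm μ ν p σ C u)
    {x : X} {r κ : ℝ} (hr : 0 < r) (hκ : 0 < κ)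
    (hνκ : ν.real (ball x (3 * σ * r)) ≤ κ * μ.real (ball x r))
    {y : X} (hyx : y ∈ ball x r) {a : ℝ} {T : ℝ}
    (hT : T = 2 * (C * 3 * (C₀⁻¹ * (3 / 2) ^ Q)) * r * κ ^ (1 / p)) (haT : T ≤ a)
    (hya : 2 * a ≤ |u y - ⨍ z in ball x (3 * r), u z ∂μ|) :
    a / 4 < |max a (min (2 * a) |u y - ⨍ z in ball x (3 * r), u z ∂μ|) -
      ⨍ z in ball y (2 * r), max a (min (2 * a) |u z - ⨍ z in ball x (3 * r), u z ∂μ|) ∂μ| := by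
  have hC0 := h.C0
  have hp0 : 0 < p := by linarith
  have hT0 : 0 < T := by rw [hT]; positivity
  have ha : 0 < a := hT0.trans_le haT
  set c := ⨍ z in ball x (3 * r), u z ∂μ with hc
  have h2r : 0 < 2 * r := by positivity
  have h3r : 0 < 3 * r := by positivity
  have hm := h.pos y h2r
  have hm3 := h.pos x h3r
  have hmem := mem_ball.1 hyx
  have hf : IsFiniteMeasure (μ.restrict (ball y (2 * r))) := ⟨by simpa using (h.hb y _ h2r).2⟩
  have hsub : ball y (2 * r) ⊆ ball x (3 * r) := ball_subset_ball' (by linarith)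
  have hup : μ.real (ball x (3 * r)) ≤ C₀⁻¹ * (3 / 2) ^ Q * μ.real (ball y (2 * r)) := by
    have := h.upper (x := x) (y := y) (R := 3 * r) (r := 2 * r) h3r
      (mem_ball.2 (by linarith)) h2r (by linarith)
    rwa [mul_div_mul_right _ _ hr.ne'] at this
  have hw1 : ∫ z in ball y (2 * r), |u z - c| ∂μ ≤ T / 2 * μ.real (ball y (2 * r)) := by
    calc _ ≤ ∫ z in ball x (3 * r), |u z - c| ∂μ :=
          setIntegral_mono_set (hv.int_abs h x h3r c) (ae_of_all _ fun _ => abs_nonneg _)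
            hsub.eventuallyLE
      _ ≤ C * (3 * r) * (ν.real (ball x (σ * (3 * r))) / μ.real (ball x (3 * r))) ^ (1 / p) *
            μ.real (ball x (3 * r)) := hv.pi x _ h3r
      _ ≤ C * (3 * r) * κ ^ (1 / p) * (C₀⁻¹ * (3 / 2) ^ Q * μ.real (ball y (2 * r))) := by
          have : ν.real (ball x (σ * (3 * r))) / μ.real (ball x (3 * r)) ≤ κ := by
            rw [div_le_iff₀ hm3, show σ * (3 * r) = 3 * σ * r by ring]
            refine hνκ.trans ?_
            have := measureReal_mono (μ := μ) (ball_subset_ball (x := x) (show r ≤ 3 * r by linarith))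
              (h.hb x _ h3r).2.ne
            gcongr
          gcongr
      _ = _ := by rw [hT]; ring
  have hmax : max a (min (2 * a) |u y - c|) = 2 * a := by
    rw [min_eq_left hya, max_eq_right (by linarith)]
  have havg : ⨍ z in ball y (2 * r), max a (min (2 * a) |u z - c|) ∂μ ≤ 3 / 2 * a := by
    have hi := trunc_int (b := 2 * a) h ((hu.sub_const c).abs) ha.le (by linarith) y h2r
    rw [setAverage_eq, smul_eq_mul, inv_mul_le_iff₀ hm]
    calc _ ≤ ∫ z in ball y (2 * r), (a + |u z - c|) ∂μ := by
          refine integral_mono hi ((integrable_const a).add (hv.int_abs h y h2r c)) fun z => ?_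
          have := abs_nonneg (u z - c)
          exact max_le (by linarith) ((min_le_right _ _).trans (by linarith))
      _ = a * μ.real (ball y (2 * r)) + ∫ z in ball y (2 * r), |u z - c| ∂μ := by
          rw [integral_add (integrable_const a) (hv.int_abs h y h2r c), integral_const]
          simp [mul_comm]
      _ ≤ a * μ.real (ball y (2 * r)) + T / 2 * μ.real (ball y (2 * r)) := by gcongr
      _ ≤ _ := by nlinarith
  rw [hmax]
  refine lt_of_lt_of_le ?_ (le_abs_self _)
  linarith

end

section
variable {X : Type*} [MetricSpace X] [MeasurableSpace X] [BorelSpace X] {C₀ Q : ℝ}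
  {μ : Measure X}

lemma sobolev_poincare (h : VD μ C₀ Q) {p σ C_P : ℝ} (hp : 1 < p) (hpQ : p < Q) (hC : 0 < C_P)
    (hσ : 1 ≤ σ)
    (hPI : ∀ (x : X) (r : ℝ), 0 < r →
      ∀ (v : X → ℝ) (ρ : X → ℝ≥0∞), Integrable v μ → Measurable ρ → IsUpperGradient v ρ →
        ⨍⁻ y in ball x r, ENNReal.ofReal |v y - ⨍ z in ball x r, v z ∂μ| ∂μ ≤
          ENNReal.ofReal (C_P * Metric.diam (ball x r)) *
            (⨍⁻ y in ball x (σ * r), ρ y ^ p ∂μ) ^ (1 / p))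
    {u : X → ℝ} {g : X → ℝ≥0∞} (hu : Measurable u)
    (hintg : ∀ (x : X) (r : ℝ), 0 < r → IntegrableOn u (ball x r) μ)
    (hg : Measurable g) (hug : IsUpperGradient u g) (hfin : ∫⁻ x, g x ^ p ∂μ < ⊤)
    (hae : ∀ᵐ y ∂μ, LebPt μ u y) :
    ∃ K6 : ℝ, 0 < K6 ∧ ∀ (x : X) (r κ : ℝ), 0 < r → 0 < κ →
      (μ.withDensity fun x => g x ^ p).real (ball x (3 * σ * r)) ≤ κ * μ.real (ball x r) →
      ∫⁻ y in ball x r,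
        ENNReal.ofReal |u y - ⨍ z in ball x (3 * r), u z ∂μ| ^ (1 / (1 / p - 1 / Q)) ∂μ ≤
      ENNReal.ofReal (K6 * r ^ (1 / (1 / p - 1 / Q)) *
        κ ^ (1 / Q * (1 / (1 / p - 1 / Q))) * κ * μ.real (ball x r)) := by
  obtain ⟨K5, hK5, hweak⟩ := weak_level (X := X) (p := p) (σ := σ) (C := 2 * C_P) (by positivity)
    hp hpQ h.C0 hσ
  have hp0 : 0 < p := by linarith
  have hQ0 : 0 < Q := by linarith
  have hC0 := h.C0
  have he0 : 0 < 1 / p - 1 / Q := by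
    have := one_div_lt_one_div_of_lt hp0 hpQ; linarith
  set H := 1 / (1 / p - 1 / Q) with hH
  have hH0 : 0 < H := by positivity
  have hHp : 1 / p * H = 1 / Q * H + 1 := by
    have : (1 / p - 1 / Q) * H = 1 := by rw [hH]; exact mul_one_div_cancel he0.ne'
    linarith
  set C3 := 2 * (2 * C_P * 3 * (C₀⁻¹ * (3 / 2) ^ Q)) with hC3
  have hC30 : 0 < C3 := by positivity
  set K := (2 : ℝ) ^ p * 3 + 2 with hK
  have hK0 : 0 < K := by positivity
  set ν := μ.withDensity fun x => g x ^ p with hν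
  have hνfin : IsFiniteMeasure ν := ⟨by
    rw [hν, withDensity_apply _ MeasurableSet.univ]; simpa using hfin⟩
  have hPIu : PIm μ ν p σ (2 * C_P) u := pim_of_pi h hp hC hσ hPI hintg hg hug hfin
  refine ⟨(2 * C3) ^ H + 4 ^ H * K5 * K ^ (1 / Q * H) * K, by positivity, ?_⟩
  intro x r κ hr hκ hνκ
  set U := ball x (3 * σ * r) with hU
  set m := μ.real (ball x r) with hm
  have hm0 : 0 < m := h.pos x hr
  set c := ⨍ z in ball x (3 * r), u z ∂μ with hc
  set T := C3 * r * κ ^ (1 / p) with hT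
  have hT0 : 0 < T := by positivity
  have hw : Measurable fun z => |u z - c| := (hu.sub_const c).abs
  set νk : ℕ → Measure X :=
    fun k => μ.withDensity fun y => rhok (fun z => |u z - c|) g T k y ^ p with hνk
  have hνkU : ∀ V : Set X, MeasurableSet V → ∑' k, νk k V ≤ (2 : ℝ≥0∞) ^ p * 3 * ν V :=
    fun V hV => nuk_sum μ hp hT0 hw hg hV
  have hνkfin : ∀ k, νk k Set.univ < ⊤ := fun k =>
    ((ENNReal.le_tsum k).trans (hνkU _ MeasurableSet.univ)).trans_lt
      (ENNReal.mul_lt_top (ENNReal.mul_lt_top (ENNReal.rpow_lt_top_of_nonneg hp0.le (by simp)) (by simp))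
        (measure_lt_top ν _))
  have hνkF : ∀ k, IsFiniteMeasure (νk k) := fun k => ⟨hνkfin k⟩
  have hTk : ∀ k : ℕ, T ≤ 2 ^ k * T := fun k => le_mul_of_one_le_left hT0.le (one_le_pow₀ one_le_two)
  have hPIk : ∀ k : ℕ, PIm μ (νk k) p σ (2 * C_P)
      (fun z => max (2 ^ k * T) (min (2 * (2 ^ k * T)) |u z - c|)) := by
    intro k
    have h2 : (2 : ℝ) * (2 ^ k * T) = 2 ^ (k + 1) * T := by ring
    have hT' : 0 < 2 ^ k * T := by positivity
    refine pim_of_pi h hp hC hσ hPI (fun y s hs => trunc_int h hw hT'.le (by linarith) y hs)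
      (rhok_meas hw hg k) ?_ ?_
    · have := (hug.abs_sub c).trunc (a := 2 ^ k * T) (b := 2 ^ (k + 1) * T) (by linarith)
        (ε := (2⁻¹ : ℝ≥0∞) ^ k) (by simp) (by simp)
      rw [h2]
      exact this
    · have := hνkfin k
      rw [hνk] at this
      simp only at this
      rw [withDensity_apply _ MeasurableSet.univ] at this
      simpa using this
  set b : ℕ → ℝ := fun k => (νk k).real U + (2⁻¹ : ℝ) ^ k * (κ * m) with hb
  have hb0 : ∀ k, 0 < b k := fun k => by positivity
  have hbsum : ∑' k, ENNReal.ofReal (b k) ≤ ENNReal.ofReal (K * (κ * m)) := by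
    have e1 : ∀ k, ENNReal.ofReal (b k) = νk k U + (2⁻¹ : ℝ≥0∞) ^ k * ENNReal.ofReal (κ * m) := by
      intro k
      rw [hb]
      simp only
      rw [ENNReal.ofReal_add (by positivity) (by positivity), ENNReal.ofReal_mul (by positivity),
        ENNReal.ofReal_pow (by positivity), ENNReal.ofReal_inv_of_pos (by norm_num)]
      unfold Measure.real
      rw [ENNReal.ofReal_toReal (measure_ne_top _ _)]
      norm_num
    simp_rw [e1]
    rw [ENNReal.tsum_add, ENNReal.tsum_mul_right, ENNReal.tsum_geometric,
      ENNReal.one_sub_inv_two, inv_inv, hK, add_mul, ENNReal.ofReal_add (by positivity) (by positivity)]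
    refine add_le_add ?_ (le_of_eq ?_)
    · refine (hνkU U measurableSet_ball).trans ?_
      rw [ENNReal.ofReal_mul (by positivity), ENNReal.ofReal_mul (by positivity),
        ← ENNReal.ofReal_rpow_of_nonneg (by norm_num) hp0.le]
      simp only [ENNReal.ofReal_ofNat]
      refine mul_le_mul' le_rfl ?_
      rw [← ENNReal.ofReal_toReal (measure_ne_top ν U)]
      exact ENNReal.ofReal_le_ofReal hνκ
    · rw [ENNReal.ofReal_mul (p := 2) (by norm_num)]; simp
  have hbk : ∀ k, b k / m ≤ K * κ := by
    intro k
    have := (ENNReal.ofReal_le_ofReal_iff (by positivity)).1 ((ENNReal.le_tsum k).trans hbsum)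
    rw [div_le_iff₀ hm0]; linarith
  set A : ℕ → Set X := fun k => {y | 2 ^ (k + 1) * T ≤ |u y - c|} ∩ ball x r with hA
  have hAm : ∀ k, MeasurableSet (A k) := fun k =>
    (measurableSet_le measurable_const hw).inter measurableSet_ball
  have hAk : ∀ k, ENNReal.ofReal ((2 ^ (k + 2) * T) ^ H) * μ (A k) ≤
      ENNReal.ofReal (4 ^ H * K5 * r ^ H * (K * κ) ^ (1 / Q * H)) * ENNReal.ofReal (b k) := by
    intro k
    have hT' : 0 < 2 ^ k * T := by positivity
    have h1 : μ (A k) = μ (A k ∩ {y | LebPt μ u y}) := by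
      refine measure_congr ?_
      filter_upwards [hae] with y hy
      exact propext ⟨fun hA => ⟨hA, hy⟩, fun hA => hA.1⟩
    have h2 := hweak μ (νk k) _ h (hPIk k) (hνkF k) x r (b k / m) (2 ^ k * T)
      (A k ∩ {y | LebPt μ u y}) hr (div_pos (hb0 k) hm0) hT'
      (by
        rw [div_mul_cancel₀ _ hm0.ne']
        rw [hb]; simp only
        have : 0 ≤ (2⁻¹ : ℝ) ^ k * (κ * m) := by positivity
        linarith)
      (fun y hy => hy.1.2)
      (fun y hy => ⟨_, LebPt.trunc h hu hintg hy.2 c hT'.le (by linarith),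
        level_gap h hp (by positivity) hu hPIu hr hκ hνκ hy.1.2 hT (hTk k) (by
          have := hy.1.1
          change 2 ^ (k + 1) * T ≤ |u y - c| at this
          rw [pow_succ] at this
          linarith)⟩)
    rw [h1]
    refine (mul_le_mul' le_rfl h2).trans ?_
    rw [← ENNReal.ofReal_mul (by positivity), ← ENNReal.ofReal_mul (by positivity)]
    refine ENNReal.ofReal_le_ofReal ?_
    have hbpos := hb0 k
    have h3 : (2 ^ (k + 2) * T) ^ H * (r / (2 ^ k * T)) ^ H = 4 ^ H * r ^ H := by
      rw [← Real.mul_rpow (by positivity) (by positivity),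
        ← Real.mul_rpow (by positivity) (by positivity)]
      congr 1
      rw [pow_add]
      field_simp
      norm_num
    calc _ = K5 * ((2 ^ (k + 2) * T) ^ H * (r / (2 ^ k * T)) ^ H) * (b k / m) ^ (1 / Q * H) *
          (b k / m * m) := by ring
      _ = K5 * (4 ^ H * r ^ H) * (b k / m) ^ (1 / Q * H) * b k := by
          rw [h3, div_mul_cancel₀ _ hm0.ne']
      _ ≤ K5 * (4 ^ H * r ^ H) * (K * κ) ^ (1 / Q * H) * b k := by
          have := hbk k
          gcongr
      _ = _ := by ring
  have hpt : ∀ y ∈ ball x r, ENNReal.ofReal |u y - c| ^ H ≤ ENNReal.ofReal ((2 * T) ^ H) +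
      ∑' k : ℕ, Set.indicator (A k) (fun _ => ENNReal.ofReal ((2 ^ (k + 2) * T) ^ H)) y := by
    intro y hy
    refine (level_sum hT0 hH0).trans (add_le_add le_rfl (ENNReal.tsum_le_tsum fun k => ?_))
    by_cases hyA : y ∈ A k
    · rw [Set.indicator_of_mem hyA]
      exact Set.indicator_le_self _ _ _
    · have hn : |u y - c| ∉ {z : ℝ | 2 ^ (k + 1) * T ≤ z} := fun hh => hyA ⟨hh, hy⟩
      rw [Set.indicator_of_notMem hn]
      exact zero_le
  calc _ ≤ ∫⁻ y in ball x r, (ENNReal.ofReal ((2 * T) ^ H) +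
      ∑' k : ℕ, Set.indicator (A k) (fun _ => ENNReal.ofReal ((2 ^ (k + 2) * T) ^ H)) y) ∂μ :=
        setLIntegral_mono' measurableSet_ball hpt
    _ = ENNReal.ofReal ((2 * T) ^ H) * μ (ball x r) +
        ∑' k : ℕ, ENNReal.ofReal ((2 ^ (k + 2) * T) ^ H) * μ.restrict (ball x r) (A k) := by
        rw [lintegral_add_left measurable_const, lintegral_tsum fun k =>
          (measurable_const.indicator (hAm k)).aemeasurable]
        simp only [lintegral_const, Measure.restrict_apply_univ, lintegral_indicator_const (hAm _)]
    _ ≤ ENNReal.ofReal ((2 * T) ^ H) * ENNReal.ofReal m +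
        ∑' k : ℕ, ENNReal.ofReal (4 ^ H * K5 * r ^ H * (K * κ) ^ (1 / Q * H)) *
          ENNReal.ofReal (b k) := by
        rw [hm, h.ofReal x hr]
        refine add_le_add le_rfl (ENNReal.tsum_le_tsum fun k => le_trans ?_ (hAk k))
        exact mul_le_mul' le_rfl (Measure.restrict_apply_le _ _)
    _ ≤ ENNReal.ofReal ((2 * T) ^ H) * ENNReal.ofReal m +
        ENNReal.ofReal (4 ^ H * K5 * r ^ H * (K * κ) ^ (1 / Q * H)) *
          ENNReal.ofReal (K * (κ * m)) := by
        rw [ENNReal.tsum_mul_left]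
        exact add_le_add le_rfl (mul_le_mul' le_rfl hbsum)
    _ = _ := by
        rw [← ENNReal.ofReal_mul (by positivity), ← ENNReal.ofReal_mul (by positivity),
          ← ENNReal.ofReal_add (by positivity) (by positivity)]
        congr 1
        have e1 : (2 * T) ^ H = (2 * C3) ^ H * r ^ H * (κ ^ (1 / Q * H) * κ) := by
          have : κ ^ (1 / Q * H) * κ = (κ ^ (1 / p)) ^ H := by
            rw [← Real.rpow_mul hκ.le, hHp, Real.rpow_add hκ, Real.rpow_one]
          rw [this, ← Real.mul_rpow (by positivity) (by positivity),
            ← Real.mul_rpow (by positivity) (by positivity), hT]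
          congr 1; ring
        rw [e1, Real.mul_rpow hK0.le hκ.le]
        ring

end

lemma pow_mix {a b A h H : ℝ} (ha : 0 ≤ a) (hb : 0 ≤ b) (hA : 0 < A) (hh : 0 < h) (hhH : h ≤ H) :
    (a + b) ^ h ≤ 2 ^ h * (A ^ h + b ^ h) + 2 ^ h * A ^ (h - H) * a ^ H := by
  have h1 : a ^ h ≤ A ^ h + A ^ (h - H) * a ^ H := by
    have n1 : 0 ≤ A ^ (h - H) * a ^ H := by positivity
    have n2 : 0 ≤ A ^ h := by positivity
    rcases le_total a A with h2 | h2
    · have : a ^ h ≤ A ^ h := Real.rpow_le_rpow ha h2 hh.le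
      linarith
    · have ha' : 0 < a := hA.trans_le h2
      have h3 : a ^ (h - H) ≤ A ^ (h - H) :=
        Real.rpow_le_rpow_of_nonpos hA h2 (sub_nonpos.2 hhH)
      have h4 : a ^ h = a ^ (h - H) * a ^ H := by rw [← Real.rpow_add ha', sub_add_cancel]
      have h5 : a ^ (h - H) * a ^ H ≤ A ^ (h - H) * a ^ H := by gcongr
      linarith
  have h0 : 0 < (2 : ℝ) ^ h := by positivity
  have h2 : (a + b) ^ h ≤ 2 ^ h * (a ^ h + b ^ h) := by
    have na : 0 ≤ a ^ h := by positivity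
    have nb : 0 ≤ b ^ h := by positivity
    rcases le_total a b with hab | hab
    · calc (a + b) ^ h ≤ (2 * b) ^ h := Real.rpow_le_rpow (by positivity) (by linarith) hh.le
        _ = 2 ^ h * b ^ h := Real.mul_rpow (by norm_num) hb
        _ ≤ _ := by nlinarith
    · calc (a + b) ^ h ≤ (2 * a) ^ h := Real.rpow_le_rpow (by positivity) (by linarith) hh.le
        _ = 2 ^ h * a ^ h := Real.mul_rpow (by norm_num) ha
        _ ≤ _ := by nlinarith
  nlinarith

section
variable {X : Type*} [MetricSpace X] [MeasurableSpace X] [BorelSpace X] {C₀ Q : ℝ}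
  {μ : Measure X}

lemma int_of_Lp (h : VD μ C₀ Q) {p : ℝ} (hp : 1 < p) {u : X → ℝ} (hu : Measurable u)
    (hL : ∫⁻ x, ENNReal.ofReal |u x| ^ p ∂μ < ⊤) (x : X) {r : ℝ} (hr : 0 < r) :
    IntegrableOn u (ball x r) μ := by
  refine ⟨hu.aestronglyMeasurable, ?_⟩
  rw [hasFiniteIntegral_iff_norm]
  calc ∫⁻ a in ball x r, ENNReal.ofReal ‖u a‖ ∂μ
      ≤ ∫⁻ a in ball x r, (1 + ENNReal.ofReal |u a| ^ p) ∂μ := by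
        refine lintegral_mono fun a => ?_
        rw [Real.norm_eq_abs]
        rcases le_total (ENNReal.ofReal |u a|) 1 with h1 | h1
        · exact h1.trans le_self_add
        · refine le_trans ?_ le_add_self
          calc _ = ENNReal.ofReal |u a| ^ (1 : ℝ) := (ENNReal.rpow_one _).symm
            _ ≤ _ := ENNReal.rpow_le_rpow_of_exponent_le h1 hp.le
    _ = μ (ball x r) + ∫⁻ a in ball x r, ENNReal.ofReal |u a| ^ p ∂μ := by
        rw [lintegral_add_left measurable_const]; simp
    _ < ⊤ := ENNReal.add_lt_top.2 ⟨(h.hb x r hr).2, (setLIntegral_le_lintegral _ _).trans_lt hL⟩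

lemma avg_pow (h : VD μ C₀ Q) {u : X → ℝ} (hu : Measurable u) {x : X} {r c a A hh H K8 K9 : ℝ}
    (hr : 0 < r) (hA : 0 < A) (hh0 : 0 < hh) (hhH : hh ≤ H) (hK8 : 0 < K8) (hK9 : 0 < K9)
    (h1 : ∫⁻ y in ball x r, ENNReal.ofReal |u y - c| ^ H ∂μ ≤
      ENNReal.ofReal (K8 * A ^ H * μ.real (ball x r)))
    (h2 : |c - a| ≤ K9 * A) :
    ⨍⁻ y in ball x r, ENNReal.ofReal |u y - a| ^ hh ∂μ ≤
      ENNReal.ofReal (2 ^ hh * (1 + K9 ^ hh + K8) * A ^ hh) := by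
  have hm0 := h.pos x hr
  have hH0 : 0 < H := by linarith
  have hpt : ∀ y, ENNReal.ofReal |u y - a| ^ hh ≤
      ENNReal.ofReal (2 ^ hh * (A ^ hh + (K9 * A) ^ hh)) +
        ENNReal.ofReal (2 ^ hh * A ^ (hh - H)) * ENNReal.ofReal |u y - c| ^ H := by
    intro y
    rw [ENNReal.ofReal_rpow_of_nonneg (abs_nonneg _) hh0.le,
      ENNReal.ofReal_rpow_of_nonneg (abs_nonneg _) hH0.le,
      ← ENNReal.ofReal_mul (by positivity), ← ENNReal.ofReal_add (by positivity) (by positivity)]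
    refine ENNReal.ofReal_le_ofReal ?_
    refine le_trans ?_ (pow_mix (abs_nonneg (u y - c)) (show 0 ≤ K9 * A by positivity) hA hh0 hhH)
    refine Real.rpow_le_rpow (abs_nonneg _) ?_ hh0.le
    exact (abs_sub_le _ c _).trans (by linarith)
  rw [setLAverage_eq]
  refine ENNReal.div_le_of_le_mul ?_
  calc _ ≤ ∫⁻ y in ball x r, (ENNReal.ofReal (2 ^ hh * (A ^ hh + (K9 * A) ^ hh)) +
        ENNReal.ofReal (2 ^ hh * A ^ (hh - H)) * ENNReal.ofReal |u y - c| ^ H) ∂μ :=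
        lintegral_mono hpt
    _ = ENNReal.ofReal (2 ^ hh * (A ^ hh + (K9 * A) ^ hh)) * μ (ball x r) +
        ENNReal.ofReal (2 ^ hh * A ^ (hh - H)) *
          ∫⁻ y in ball x r, ENNReal.ofReal |u y - c| ^ H ∂μ := by
        rw [lintegral_add_left measurable_const, lintegral_const_mul' _ _ (by simp)]
        simp
    _ ≤ ENNReal.ofReal (2 ^ hh * (A ^ hh + (K9 * A) ^ hh)) * ENNReal.ofReal (μ.real (ball x r)) +
        ENNReal.ofReal (2 ^ hh * A ^ (hh - H)) *
          ENNReal.ofReal (K8 * A ^ H * μ.real (ball x r)) := by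
        rw [h.ofReal x hr]
        exact add_le_add le_rfl (mul_le_mul' le_rfl h1)
    _ = _ := by
        rw [← h.ofReal x hr, ← ENNReal.ofReal_mul (by positivity), ← ENNReal.ofReal_mul (by positivity),
          ← ENNReal.ofReal_add (by positivity) (by positivity), ← ENNReal.ofReal_mul (by positivity)]
        congr 1
        have e1 : A ^ hh = A ^ (hh - H) * A ^ H := by rw [← Real.rpow_add hA, sub_add_cancel]
        rw [Real.mul_rpow hK9.le hA.le]
        calc _ = 2 ^ hh * (A ^ hh + K9 ^ hh * A ^ hh) * μ.real (ball x r) +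
            2 ^ hh * K8 * (A ^ (hh - H) * A ^ H) * μ.real (ball x r) := by ring
          _ = _ := by rw [← e1]; ring

lemma int_fin {F : ℝ → ℝ≥0∞} {K α h p δ : ℝ} (hK : 0 < K) (hα : 0 < α) (hh : 0 < h) (hp : 1 < p)
    (hδ : 0 < δ) (hF : ∀ r, 0 < r → r < δ → F r ≤ ENNReal.ofReal (K * (r ^ α) ^ h)) :
    ∫⁻ r in Set.Ioo (0 : ℝ) δ, F r ^ (p / (h * (p - 1))) / ENNReal.ofReal r < ⊤ := by
  have hp1 : 0 < p - 1 := by linarith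
  have hp0 : 0 < p := by linarith
  set t := p / (h * (p - 1)) with ht
  have ht0 : 0 < t := by positivity
  have hi : IntegrableOn (fun r : ℝ => K ^ t * r ^ (α * h * t - 1)) (Set.Ioo 0 δ) :=
    ((intervalIntegral.integrableOn_Ioo_rpow_iff hδ).2 (by
      have : 0 < α * h * t := by positivity
      linarith)).const_mul _
  refine lt_of_le_of_lt ?_ hi.lintegral_lt_top
  refine setLIntegral_mono' measurableSet_Ioo fun r hr => ?_
  have hr0 : 0 < r := hr.1
  calc F r ^ t / ENNReal.ofReal r ≤ ENNReal.ofReal (K * (r ^ α) ^ h) ^ t / ENNReal.ofReal r := by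
        gcongr
        exact hF r hr.1 hr.2
    _ = ENNReal.ofReal ((K * (r ^ α) ^ h) ^ t / r) := by
        rw [ENNReal.ofReal_rpow_of_nonneg (by positivity) ht0.le, ENNReal.ofReal_div_of_pos hr0]
    _ = _ := by
        congr 1
        rw [Real.mul_rpow hK.le (by positivity), ← Real.rpow_mul hr0.le, ← Real.rpow_mul hr0.le,
          Real.rpow_sub hr0, Real.rpow_one, mul_div_assoc]
    _ ≤ _ := le_rfl

lemma main_aux (h : VD μ C₀ Q) {p q hh δ σ C_P : ℝ} (hp : 1 < p) (hpQ : p < Q) (hC : 0 < C_P)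
    (hσ : 1 ≤ σ) (hq : 1 < q) (hqp : q < p) (hδ : 0 < δ) (hh0 : 0 < hh)
    (hhH : hh ≤ 1 / (1 / p - 1 / Q))
    (hPI : ∀ (x : X) (r : ℝ), 0 < r →
      ∀ (v : X → ℝ) (ρ : X → ℝ≥0∞), Integrable v μ → Measurable ρ → IsUpperGradient v ρ →
        ⨍⁻ y in ball x r, ENNReal.ofReal |v y - ⨍ z in ball x r, v z ∂μ| ∂μ ≤
          ENNReal.ofReal (C_P * Metric.diam (ball x r)) *
            (⨍⁻ y in ball x (σ * r), ρ y ^ p ∂μ) ^ (1 / p))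
    (u : X → ℝ) (hu : MemN1p μ p u)
    (hprec : ∀ x : X, u x = limsup (fun r => ⨍ y in ball x r, u y ∂μ) (𝓝[>] (0 : ℝ))) :
    sobolevCapacity μ q {x : X | ∫⁻ r in Set.Ioo (0 : ℝ) δ,
        (⨍⁻ y in ball x r, ENNReal.ofReal |u y - u x| ^ hh ∂μ) ^ (p / (hh * (p - 1)))
          / ENNReal.ofReal r = ⊤} = 0 := by
  obtain ⟨hum, huL, g, hg, hug, hfin⟩ := hu
  have hintg : ∀ (x : X) (r : ℝ), 0 < r → IntegrableOn u (ball x r) μ :=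
    fun x r hr => int_of_Lp h hp hum huL x hr
  have hp0 : 0 < p := by linarith
  have hq0 : 0 < q := by linarith
  have hQ0 : 0 < Q := by linarith
  have hC0 := h.C0
  have hPIu := pim_of_pi h hp hC hσ hPI hintg hg hug hfin
  have hα : 0 < 1 - q / p := by
    have : q / p < 1 := (div_lt_one hp0).2 hqp
    linarith
  have hR : 0 < 3 * δ := by positivity
  have hνfin : IsFiniteMeasure (μ.withDensity fun x => g x ^ p) := ⟨by
    rw [withDensity_apply _ MeasurableSet.univ]; simpa using hfin⟩
  have hcap := bad_capacity (ν := μ.withDensity fun x => g x ^ p) (q := q) h hσ hq0 hR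
  have hbad : μ {y | ¬ Good μ (μ.withDensity fun x => g x ^ p) σ q (3 * δ) y} = 0 := by
    rw [← nonpos_iff_eq_zero, ← hcap]
    exact measure_le_capacity μ hq0 _
  have hae : ∀ᵐ y ∂μ, LebPt μ u y := by
    have : ∀ᵐ y ∂μ, Good μ (μ.withDensity fun x => g x ^ p) σ q (3 * δ) y := hbad
    filter_upwards [this] with y hy
    obtain ⟨K, hK, hKs⟩ := good_est h hPIu (by positivity) hq0 hqp hR hy (hprec y)
    refine ⟨fun s => K * s ^ (1 - q / p), ?_, ?_⟩
    · have h1 : Tendsto (fun s : ℝ => K * s ^ (1 - q / p)) (𝓝 0) (𝓝 (K * 0 ^ (1 - q / p))) :=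
        ((Real.continuousAt_rpow_const 0 _ (Or.inr hα.le)).tendsto).const_mul K
      rw [Real.zero_rpow hα.ne', mul_zero] at h1
      exact h1.mono_left nhdsWithin_le_nhds
    · filter_upwards [Ioo_mem_nhdsGT hR] with s hs
      exact (hKs s hs.1 hs.2.le).2
  obtain ⟨K6, hK6, hSP⟩ := sobolev_poincare h hp hpQ hC hσ hPI hum hintg hg hug hfin hae
  have he0 : 0 < 1 / p - 1 / Q := by
    have := one_div_lt_one_div_of_lt hp0 hpQ; linarith
  set H := 1 / (1 / p - 1 / Q) with hH
  have hH0 : 0 < H := by positivity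
  have hHp : 1 / p * H = 1 / Q * H + 1 := by
    have : (1 / p - 1 / Q) * H = 1 := by rw [hH]; exact mul_one_div_cancel he0.ne'
    linarith
  rw [← nonpos_iff_eq_zero, ← hcap]
  refine sobolevCapacity_mono μ q fun x hx hgood => ?_
  obtain ⟨K, hK, hKs⟩ := good_est h hPIu (by positivity) hq0 hqp hR hgood (hprec x)
  obtain ⟨M, hM, hMs⟩ := hgood
  refine absurd hx (ne_of_lt ?_)
  set κ0 := M * (C₀⁻¹ * 3 ^ Q) * (3 ^ q)⁻¹ with hκ0
  have hκ00 : 0 < κ0 := by positivity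
  refine int_fin (K := 2 ^ hh * (1 + (K * 3 ^ (1 - q / p)) ^ hh + K6 * κ0 ^ (1 / p * H)))
    (α := 1 - q / p) (by positivity) hα hh0 hp hδ fun r hr hrδ => ?_
  have hm0 := h.pos x hr
  have h3r : 0 < 3 * r := by positivity
  refine avg_pow h hum hr (c := ⨍ z in ball x (3 * r), u z ∂μ) (H := H) (by positivity) hh0 hhH (by positivity) (by positivity) ?_ ?_
  · have hκ : 0 < κ0 * (r ^ q)⁻¹ := by positivity
    refine (hSP x r (κ0 * (r ^ q)⁻¹) hr hκ ?_).trans (ENNReal.ofReal_le_ofReal (le_of_eq ?_))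
    · have h1 := hMs (3 * r) h3r (by linarith)
      have h2 := h.scale x (a := 3) hr (by norm_num)
      rw [show σ * (3 * r) = 3 * σ * r by ring, ← le_div_iff₀ (by positivity)] at h1
      refine h1.trans ?_
      rw [div_le_iff₀ (by positivity), Real.mul_rpow (by norm_num) hr.le]
      calc _ ≤ M * (C₀⁻¹ * 3 ^ Q * μ.real (ball x r)) := by gcongr
        _ = _ := by rw [hκ0]; field_simp
    · have e1 : (κ0 * (r ^ q)⁻¹) ^ (1 / Q * H) * (κ0 * (r ^ q)⁻¹) =
          κ0 ^ (1 / p * H) * r ^ (-(q / p) * H) := by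
        have : (κ0 * (r ^ q)⁻¹) ^ (1 / Q * H) * (κ0 * (r ^ q)⁻¹) =
            (κ0 * (r ^ q)⁻¹) ^ (1 / p * H) := by
          rw [hHp, Real.rpow_add hκ, Real.rpow_one]
        rw [this, Real.mul_rpow hκ00.le (by positivity), ← Real.rpow_neg hr.le,
          ← Real.rpow_mul hr.le]
        congr 2; ring
      have e2 : r ^ H * r ^ (-(q / p) * H) = (r ^ (1 - q / p)) ^ H := by
        rw [← Real.rpow_add hr, ← Real.rpow_mul hr.le]
        congr 1; ring
      calc _ = K6 * r ^ H * ((κ0 * (r ^ q)⁻¹) ^ (1 / Q * H) * (κ0 * (r ^ q)⁻¹)) *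
            μ.real (ball x r) := by ring
        _ = K6 * κ0 ^ (1 / p * H) * (r ^ H * r ^ (-(q / p) * H)) * μ.real (ball x r) := by
            rw [e1]; ring
        _ = _ := by rw [e2]
  · have := (hKs (3 * r) h3r (by linarith)).1
    rw [Real.mul_rpow (by norm_num) hr.le] at this
    linarith

end

/-- **Main theorem, part (i).** Let `(X, d, μ)` be complete, with a Borel regular
doubling measure positive and finite on balls, supporting a `p`-Poincaré inequality and having
relative lower volume decay of order `Q > 0`. Suppose either `1 < p < Q` and
`0 < h ≤ Qp/(Q−p)`, or `p = Q > 1` and `h > 0`. Let `1 < q < p`, `0 < δ < ∞` and let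
`u ∈ N^{1,p}(X)` be pointwise defined everywhere by its precise representative. Then the set
`E = { x : ∫_0^δ ( ⨍_{B(x,r)} |u − u(x)|^h dμ )^{p/(h(p−1))} dr/r = ∞ }` satisfies
`C_q(E) = 0`. -/
theorem stmt_9 {X : Type*} [MetricSpace X] [CompleteSpace X]
    [MeasurableSpace X] [BorelSpace X] (μ : Measure X)
    (hreg : ∀ s : Set X, ∃ B : Set X, MeasurableSet B ∧ s ⊆ B ∧ μ B = μ s)
    (hball : ∀ (x : X) (r : ℝ), 0 < r → 0 < μ (ball x r) ∧ μ (ball x r) < ⊤)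
    (hdbl : ∃ Cμ : ℝ≥0∞, 1 ≤ Cμ ∧ ∀ (x : X) (r : ℝ), 0 < r →
      μ (ball x (2 * r)) ≤ Cμ * μ (ball x r))
    (p q h Q δ : ℝ) (hQpos : 0 < Q)
    (hQdecay : ∃ C₀ : ℝ, 0 < C₀ ∧ ∀ (x y : X) (R r : ℝ), 0 < R → y ∈ ball x R →
      0 < r → r ≤ R → ENNReal.ofReal (C₀ * (r / R) ^ Q) * μ (ball x R) ≤ μ (ball y r))
    (hcase : (1 < p ∧ p < Q ∧ 0 < h ∧ h ≤ Q * p / (Q - p)) ∨ (p = Q ∧ 1 < p ∧ 0 < h))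
    (hq : 1 < q) (hqp : q < p) (hδ : 0 < δ)
    (hPI : ∃ C_P : ℝ, 0 < C_P ∧ ∃ σ : ℝ, 1 ≤ σ ∧ ∀ (x : X) (r : ℝ), 0 < r →
      ∀ (v : X → ℝ) (ρ : X → ℝ≥0∞), Integrable v μ → Measurable ρ → IsUpperGradient v ρ →
        ⨍⁻ y in ball x r, ENNReal.ofReal |v y - ⨍ z in ball x r, v z ∂μ| ∂μ ≤
          ENNReal.ofReal (C_P * Metric.diam (ball x r)) *
            (⨍⁻ y in ball x (σ * r), ρ y ^ p ∂μ) ^ (1 / p))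
    (u : X → ℝ) (hu : MemN1p μ p u)
    (hprec : ∀ x : X, u x = limsup (fun r => ⨍ y in ball x r, u y ∂μ) (𝓝[>] (0 : ℝ))) :
    sobolevCapacity μ q {x : X | ∫⁻ r in Set.Ioo (0 : ℝ) δ,
        (⨍⁻ y in ball x r, ENNReal.ofReal |u y - u x| ^ h ∂μ) ^ (p / (h * (p - 1)))
          / ENNReal.ofReal r = ⊤} = 0 := by
  obtain ⟨C₀, hC₀, hdec⟩ := hQdecay
  obtain ⟨C_P, hC_P, σ, hσ, hPI⟩ := hPI
  have hp : 1 < p := by rcases hcase with hc | hc <;> tauto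
  have hp0 : 0 < p := by linarith
  have hh0 : 0 < h := by rcases hcase with hc | hc <;> tauto
  have hVD : ∀ Q' : ℝ, Q ≤ Q' → VD μ C₀ Q' := by
    intro Q' hQ'
    refine ⟨hC₀, by linarith, hball, fun x y R r hR hy hr hrR => ?_⟩
    have h1 := hdec x y R r hR hy hr hrR
    have h2 : C₀ * (r / R) ^ Q * μ.real (ball x R) ≤ μ.real (ball y r) := by
      have h3 := ENNReal.toReal_mono (hball y r hr).2.ne h1
      rw [ENNReal.toReal_mul, ENNReal.toReal_ofReal (by positivity)] at h3
      exact h3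
    refine le_trans ?_ h2
    have h4 : (r / R) ^ Q' ≤ (r / R) ^ Q :=
      Real.rpow_le_rpow_of_exponent_ge (by positivity) ((div_le_one hR).2 hrR) hQ'
    gcongr
  have hexp : ∀ Q' : ℝ, p < Q' → 1 / (1 / p - 1 / Q') = Q' * p / (Q' - p) := by
    intro Q' hQ'
    have h1 : 0 < Q' := by linarith
    have h2 : Q' - p ≠ 0 := by linarith
    have h3 : 1 / p - 1 / Q' = (Q' - p) / (Q' * p) := by field_simp
    rw [h3, one_div_div]
  obtain ⟨Q', hQQ', hpQ', hhQ'⟩ : ∃ Q', Q ≤ Q' ∧ p < Q' ∧ h ≤ 1 / (1 / p - 1 / Q') := by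
    rcases hcase with ⟨_, hc2, _, hc4⟩ | ⟨hc1, _, _⟩
    · exact ⟨Q, le_rfl, hc2, by rw [hexp Q hc2]; exact hc4⟩
    · have h1 : 0 < p ^ 2 / h := by positivity
      refine ⟨p + p ^ 2 / h, by linarith, by linarith, ?_⟩
      rw [hexp _ (by linarith)]
      have : (p + p ^ 2 / h) * p / (p + p ^ 2 / h - p) = h + p := by
        rw [add_sub_cancel_left]; field_simp
      rw [this]; linarith
  exact main_aux (hVD Q' hQQ') hp hpQ' hC_P hσ hq hqp hδ hh0 hhQ' hPI u hu hprec
end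

section
/- Suppose p > Q > 0, let h > 0 and 0 < δ < ∞, and let u ∈ N^{1,p}(X) be pointwise defined everywhere by its precise representative. Then ∫_X ( ∫_0^δ ( ⨍_{B(x,r)} |u − u(x)|^h dμ )^{p/(h(p−1))} dr/r )^{p−1} dμ(x) < ∞. -/
open MeasureTheory Metric Filter ENNReal Topology

lemma telescope (m : ℝ → ℝ) (α C r : ℝ) (hα : 0 < α) (hC : 0 ≤ C)
    (H : ∀ ρ, 0 < ρ → ρ ≤ r → ∀ s, ρ / 2 ≤ s → s ≤ ρ → |m s - m ρ| ≤ C * ρ ^ α) :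
    ∀ s, 0 < s → s ≤ r → |m s - m r| ≤ C / (1 - (1 / 2 : ℝ) ^ α) * r ^ α := by
  have hθ : (1 / 2 : ℝ) ^ α < 1 := Real.rpow_lt_one (by norm_num) (by norm_num) hα
  have hθ0 : 0 < (1 / 2 : ℝ) ^ α := by positivity
  set θ := (1 / 2 : ℝ) ^ α with hθd
  set D := C / (1 - θ) with hD
  have hDC : C + D * θ = D := by
    rw [hD]; field_simp [show (1 - θ) ≠ 0 by linarith]; ring
  have hD0 : 0 ≤ D := div_nonneg hC (by linarith)
  have hCD : C ≤ D := by nlinarith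
  have key : ∀ n : ℕ, ∀ ρ, 0 < ρ → ρ ≤ r → ∀ s, ρ * (1 / 2) ^ n ≤ s → s ≤ ρ →
      |m s - m ρ| ≤ D * ρ ^ α := by
    intro n
    induction n with
    | zero =>
      intro ρ hρ hr s h1 h2
      have : s = ρ := le_antisymm h2 (by simpa using h1)
      subst this
      simp only [sub_self, abs_zero]; positivity
    | succ n ih =>
      intro ρ hρ hr s h1 h2
      by_cases h : ρ / 2 ≤ s
      · exact (H ρ hρ hr s h h2).trans (by gcongr)
      · push Not at h
        have h3 := ih (ρ / 2) (by linarith) (by linarith) s (by rw [pow_succ] at h1; linarith) h.le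
        have h4 := H ρ hρ hr (ρ / 2) le_rfl (by linarith)
        have h5 : (ρ / 2) ^ α = θ * ρ ^ α := by
          rw [hθd, ← Real.mul_rpow (by norm_num) hρ.le]; congr 1; ring
        rw [h5] at h3
        have h6 := abs_sub_le (m s) (m (ρ / 2)) (m ρ)
        have h7 : D * ρ ^ α = C * ρ ^ α + D * (θ * ρ ^ α) := by
          conv_lhs => rw [← hDC]
          ring
        linarith
  intro s hs hsr
  have hr : 0 < r := hs.trans_le hsr
  obtain ⟨n, hn⟩ := exists_pow_lt_of_lt_one (show 0 < s / r by positivity) (show (1 / 2 : ℝ) < 1 by norm_num)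
  refine key n r hr le_rfl s ?_ hsr
  rw [lt_div_iff₀ hr] at hn
  linarith

section
variable {X : Type*} [MetricSpace X] [MeasurableSpace X] [BorelSpace X] (μ : Measure X)

def BallPos : Prop := ∀ (x : X) (r : ℝ), 0 < r → 0 < μ (ball x r) ∧ μ (ball x r) < ⊤

def Decay (Q C₀ : ℝ) : Prop := ∀ (x y : X) (R r : ℝ), 0 < R → y ∈ ball x R →
      0 < r → r ≤ R → ENNReal.ofReal (C₀ * (r / R) ^ Q) * μ (ball x R) ≤ μ (ball y r)

variable {μ}
lemma avg_le (hball : BallPos μ) {Q C₀ : ℝ} (hC : 0 < C₀) (hd : Decay μ Q C₀)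
    (f : X → ℝ≥0∞) {x z : X} {ρ s : ℝ} (hz : z ∈ ball x ρ) (hs : 0 < s) (hsρ : s ≤ ρ)
    (hsub : ball z s ⊆ ball x ρ) :
    ⨍⁻ y in ball z s, f y ∂μ ≤
      ENNReal.ofReal ((ρ / s) ^ Q / C₀) * ⨍⁻ y in ball x ρ, f y ∂μ := by
  have hρ : 0 < ρ := hs.trans_le hsρ
  rw [setLAverage_eq, setLAverage_eq]
  have h1 := hd x z ρ s hρ hz hs hsρ
  have e : (ρ / s) ^ Q / C₀ = (C₀ * (s / ρ) ^ Q)⁻¹ := by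
    rw [show ρ / s = (s / ρ)⁻¹ by rw [inv_div], Real.inv_rpow (by positivity), mul_inv]
    field_simp
  have hpos : 0 < C₀ * (s / ρ) ^ Q := by positivity
  rw [e, ENNReal.ofReal_inv_of_pos hpos, div_eq_mul_inv, div_eq_mul_inv]
  have h2 : (μ (ball z s))⁻¹ ≤ (ENNReal.ofReal (C₀ * (s / ρ) ^ Q))⁻¹ * (μ (ball x ρ))⁻¹ := by
    rw [← ENNReal.mul_inv (Or.inr (hball x ρ hρ).2.ne) (Or.inl ENNReal.ofReal_ne_top)]
    exact ENNReal.inv_le_inv.2 h1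
  calc _ ≤ (∫⁻ y in ball x ρ, f y ∂μ) * ((ENNReal.ofReal (C₀ * (s / ρ) ^ Q))⁻¹ * (μ (ball x ρ))⁻¹) := by
        gcongr
    _ = _ := by rw [div_eq_mul_inv (lintegral _ _)]; ring

lemma secondCountable_of (hball : BallPos μ) [SFinite μ] : SecondCountableTopology X := by
  refine Metric.secondCountable_of_almost_dense_set fun ε hε => ?_
  obtain ⟨S, hS⟩ := zorn_subset {S : Set X | S.Pairwise fun a b => ε ≤ dist a b} (by
    intro c hc hchain
    refine ⟨⋃₀ c, ?_, fun s hs => Set.subset_sUnion_of_mem hs⟩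
    exact (Set.pairwise_sUnion hchain.directedOn).2 fun s hs => hc hs)
  refine ⟨S, ?_, fun x => ?_⟩
  · have := Measure.countable_meas_pos_of_disjoint_iUnion (μ := μ) (ι := S)
      (As := fun a => ball (a : X) (ε / 2)) (fun a => measurableSet_ball) (by
        intro a b hab
        refine ball_disjoint_ball ?_
        have := hS.prop a.2 b.2 (fun h => hab (Subtype.ext h))
        simpa using this)
    have h2 : {i : S | 0 < μ (ball (i : X) (ε / 2))} = Set.univ := by
      ext i; simp only [Set.mem_ofPred_eq, Set.mem_univ, iff_true]
      exact (hball i _ (by linarith)).1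
    rw [h2] at this
    exact Set.countable_coe_iff.1 (Set.countable_univ_iff.1 this)
  · by_contra hx
    push Not at hx
    have hxS : x ∉ S := fun h => by have := hx x h; simp at this; linarith
    have : insert x S ∈ {S : Set X | S.Pairwise fun a b => ε ≤ dist a b} := by
      refine hS.prop.insert fun b hb _ => ⟨(hx b hb).le, ?_⟩
      rw [dist_comm]; exact (hx b hb).le
    exact hxS (hS.le_of_ge this (Set.subset_insert x S) (Set.mem_insert x S))

lemma sigmaFinite_of (hball : BallPos μ) : SigmaFinite μ := by
  rcases isEmpty_or_nonempty X with h | ⟨⟨x⟩⟩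
  · rw [Measure.eq_zero_of_isEmpty μ]; infer_instance
  · refine ⟨⟨⟨fun n => ball x (n + 1), fun _ => trivial, fun n => (hball x _ (by positivity)).2, ?_⟩⟩⟩
    refine Set.eq_univ_of_forall fun y => Set.mem_iUnion.2 ?_
    obtain ⟨n, hn⟩ := exists_nat_gt (dist y x)
    exact ⟨n, by simp only [mem_ball]; linarith⟩

open Classical in
lemma exists_majorant (hball : BallPos μ) {Q C₀ : ℝ} (hC : 0 < C₀) (hd : Decay μ Q C₀)
    (f : X → ℝ≥0∞) (hf : Measurable f) (R : ℝ) (hR : 0 < R) :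
    ∃ N : X → ℝ≥0∞, Measurable N ∧ (∀ x, ⨍⁻ y in ball x R, f y ∂μ ≤ N x) ∧
      ∫⁻ x, N x ∂μ ≤ ENNReal.ofReal C₀⁻¹ * ∫⁻ x, f x ∂μ := by
  have := sigmaFinite_of hball
  have := secondCountable_of hball
  have hS : MeasurableSet {q : X × X | dist q.1 q.2 < R} :=
    (isOpen_lt (by fun_prop) continuous_const).measurableSet
  have hm : Measurable fun y => μ (ball y R) := by
    have := measurable_measure_prodMk_left (ν := μ) hS
    convert this using 3 with y
    ext z; simp [dist_comm]
  let F : X × X → ℝ≥0∞ := {q : X × X | dist q.1 q.2 < R}.indicator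
    (fun q => ENNReal.ofReal C₀⁻¹ * (f q.2 / μ (ball q.2 R)))
  have hF : Measurable F := by
    refine Measurable.indicator ?_ hS
    exact (((hf.comp measurable_snd).div (hm.comp measurable_snd))).const_mul _
  refine ⟨fun x => ∫⁻ y, F (x, y) ∂μ, hF.lintegral_prod_right', fun x => ?_, ?_⟩
  · rw [setLAverage_eq, div_eq_mul_inv, ← lintegral_mul_const _ hf,
      ← lintegral_indicator measurableSet_ball]
    refine lintegral_mono fun y => ?_
    by_cases hy : dist x y < R
    · have hy' : y ∈ ball x R := by simpa [dist_comm] using hy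
      have e : F (x, y) = ENNReal.ofReal C₀⁻¹ * (f y / μ (ball y R)) :=
        Set.indicator_of_mem (s := {q : X × X | dist q.1 q.2 < R}) (show (x, y) ∈ _ from hy) _
      rw [e, Set.indicator_of_mem hy', div_eq_mul_inv, mul_left_comm]
      refine mul_le_mul_right ?_ _
      have := hd y x R R hR (by simpa using hy) hR le_rfl
      rw [div_self hR.ne', Real.one_rpow, mul_one] at this
      rw [ENNReal.ofReal_inv_of_pos hC, ← ENNReal.mul_inv (Or.inr (hball y R hR).2.ne) (Or.inl ENNReal.ofReal_ne_top)]
      exact ENNReal.inv_le_inv.2 this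
    · have hy' : y ∉ ball x R := by simpa [dist_comm] using hy
      rw [Set.indicator_of_notMem hy']
      exact zero_le
  · rw [lintegral_lintegral_swap (f := fun x y => F (x, y)) hF.aemeasurable, ← lintegral_const_mul _ hf]
    refine lintegral_mono fun y => ?_
    have : ∀ x, F (x, y) = (ball y R).indicator (fun _ => ENNReal.ofReal C₀⁻¹ * (f y / μ (ball y R))) x := by
      intro x
      simp [F, Set.indicator, mem_ball]
    simp only [this]
    rw [lintegral_indicator_const measurableSet_ball, mul_assoc,
      ENNReal.div_mul_cancel (hball y R hR).1.ne' (hball y R hR).2.ne]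

end

section
variable {X : Type*} [MetricSpace X] [MeasurableSpace X] [BorelSpace X] {μ : Measure X}

lemma local_upperGradient (u : X → ℝ) (g : X → ℝ≥0∞) (hg : IsUpperGradient u g) (x : X)
    (a b : ℝ) (hab : a < b) :
    IsUpperGradient ((ball x b).indicator u) (fun y => g y + (ball x a)ᶜ.indicator (fun _ => ⊤) y) := by
  intro l γ hl hγ
  have hc := hγ.continuousOn
  by_cases hout : ∃ t ∈ Set.Icc 0 l, γ t ∉ ball x b
  · obtain ⟨t, ht, hxt⟩ := hout
    have : ∫⁻ t in Set.Icc (0 : ℝ) l, (g (γ t) + (ball x a)ᶜ.indicator (fun _ => ⊤) (γ t)) = ⊤ := by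
      have hU : {y | a < dist y x} ∈ 𝓝 (γ t) := by
        refine (isOpen_lt continuous_const (by fun_prop)).mem_nhds ?_
        simp only [mem_ball, not_lt] at hxt
        simp only [Set.mem_ofPred_eq]; linarith
      have h1 := hc t ht hU
      rw [Filter.mem_map, Metric.mem_nhdsWithin_iff] at h1
      obtain ⟨ε, hε, hsub⟩ := h1
      have hpos : 0 < volume (Set.Icc (max 0 (t - ε/2)) (min l (t + ε/2))) := by
        rw [Real.volume_Icc, ENNReal.ofReal_pos, sub_pos, max_lt_iff, lt_min_iff, lt_min_iff]
        obtain ⟨h0, hl'⟩ := ht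
        refine ⟨⟨hl, by linarith⟩, by linarith, by linarith⟩
      rw [eq_top_iff]
      calc ⊤ = ∫⁻ t in Set.Icc (max 0 (t - ε/2)) (min l (t + ε/2)), (⊤ : ℝ≥0∞) := by
            rw [setLIntegral_const, ENNReal.top_mul hpos.ne']
        _ ≤ ∫⁻ t in Set.Icc (max 0 (t - ε/2)) (min l (t + ε/2)), (g (γ t) + (ball x a)ᶜ.indicator (fun _ => ⊤) (γ t)) := by
            refine setLIntegral_mono' measurableSet_Icc fun s hs => ?_
            have : γ s ∈ (ball x a)ᶜ := by
              have : s ∈ ball t ε ∩ Set.Icc 0 l := by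
                simp only [Set.mem_Icc, max_le_iff, le_min_iff] at hs
                refine ⟨?_, hs.1.1, hs.2.1⟩
                rw [mem_ball, Real.dist_eq, abs_lt]
                constructor <;> linarith
              have := hsub this
              simp only [Set.mem_preimage, Set.mem_ofPred_eq] at this
              simp only [Set.mem_compl_iff, mem_ball, not_lt]; linarith
            rw [Set.indicator_of_mem this]; simp
        _ ≤ _ := lintegral_mono_set (Set.Icc_subset_Icc (le_max_left _ _) (min_le_left _ _))
    rw [this]; exact le_top
  · push Not at hout
    rw [Set.indicator_of_mem (hout 0 ⟨le_rfl, hl.le⟩), Set.indicator_of_mem (hout l ⟨hl.le, le_rfl⟩)]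
    exact (hg l γ hl hγ).trans (lintegral_mono fun t => le_self_add)

def PI (μ : Measure X) (p C_P σ : ℝ) : Prop := ∀ (x : X) (r : ℝ), 0 < r →
      ∀ (v : X → ℝ) (ρ : X → ℝ≥0∞), Integrable v μ → Measurable ρ → IsUpperGradient v ρ →
        ⨍⁻ y in ball x r, ENNReal.ofReal |v y - ⨍ z in ball x r, v z ∂μ| ∂μ ≤
          ENNReal.ofReal (C_P * Metric.diam (ball x r)) *
            (⨍⁻ y in ball x (σ * r), ρ y ^ p ∂μ) ^ (1 / p)

lemma integrableOn_ball (hball : BallPos μ) {p : ℝ} (hp : 1 < p) (u : X → ℝ) (hu : Measurable u)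
    (hup : (∫⁻ x, ENNReal.ofReal |u x| ^ p ∂μ) < ⊤) (x : X) (r : ℝ) (hr : 0 < r) :
    IntegrableOn u (ball x r) μ := by
  have hm : MemLp u (ENNReal.ofReal p) μ := by
    refine ⟨hu.aestronglyMeasurable, ?_⟩
    rw [eLpNorm_lt_top_iff_lintegral_rpow_enorm_lt_top (by simp; linarith) (by simp)]
    rw [ENNReal.toReal_ofReal (by linarith)]
    simpa only [← ofReal_norm, Real.norm_eq_abs] using hup
  have : IsFiniteMeasure (μ.restrict (ball x r)) := ⟨by simpa using (hball x r hr).2⟩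
  exact (hm.restrict _).integrable (by simpa using hp.le)

lemma PI_local (hball : BallPos μ) {p C_P σ : ℝ} (hp : 1 < p) (hC : 0 < C_P) (hσ : 1 ≤ σ)
    (hPI : PI μ p C_P σ) (u : X → ℝ) (hu : Measurable u)
    (hup : (∫⁻ x, ENNReal.ofReal |u x| ^ p ∂μ) < ⊤) (g : X → ℝ≥0∞) (hg : Measurable g)
    (hug : IsUpperGradient u g) (x : X) (r : ℝ) (hr : 0 < r) :
    ⨍⁻ y in ball x r, ENNReal.ofReal |u y - ⨍ z in ball x r, u z ∂μ| ∂μ ≤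
          ENNReal.ofReal (C_P * (2 * r)) *
            (⨍⁻ y in ball x (σ * r), g y ^ p ∂μ) ^ (1 / p) := by
  have hσr : r ≤ σ * r := by nlinarith
  have hb : 0 < 2 * (σ * r) := by linarith
  have hsub : ball x r ⊆ ball x (2 * (σ * r)) := ball_subset_ball (by linarith)
  have H := hPI x r hr _ _ ((integrable_indicator_iff measurableSet_ball).2
    (integrableOn_ball hball hp u hu hup x _ hb))
    (hg.add (measurable_const.indicator measurableSet_ball.compl))
    (local_upperGradient u g hug x (σ * r) (2 * (σ * r)) (by linarith))
  have e1 : ⨍ z in ball x r, (ball x (2 * (σ * r))).indicator u z ∂μ = ⨍ z in ball x r, u z ∂μ := by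
    rw [setAverage_eq, setAverage_eq]
    congr 1
    exact setIntegral_congr_fun measurableSet_ball fun y hy => Set.indicator_of_mem (hsub hy) u
  rw [e1] at H
  have e2 : ⨍⁻ y in ball x r, ENNReal.ofReal |(ball x (2 * (σ * r))).indicator u y - ⨍ z in ball x r, u z ∂μ| ∂μ
      = ⨍⁻ y in ball x r, ENNReal.ofReal |u y - ⨍ z in ball x r, u z ∂μ| ∂μ := by
    rw [setLAverage_eq, setLAverage_eq]
    congr 1
    exact setLIntegral_congr_fun measurableSet_ball fun y hy => by
      simp only [Set.indicator_of_mem (hsub hy)]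
  rw [e2] at H
  have e3 : ⨍⁻ y in ball x (σ * r), ((fun y => g y + (ball x (σ * r))ᶜ.indicator (fun _ => ⊤) y) y) ^ p ∂μ
      = ⨍⁻ y in ball x (σ * r), g y ^ p ∂μ := by
    rw [setLAverage_eq, setLAverage_eq]
    congr 1
    exact setLIntegral_congr_fun measurableSet_ball fun y hy => by
      simp only [Set.indicator_of_notMem (show y ∉ (ball x (σ * r))ᶜ by simpa using hy), add_zero]
  refine H.trans ?_
  rw [← e3]
  have := Metric.diam_ball (x := x) hr.le
  gcongr
  rfl

lemma mean_diff (hball : BallPos μ) {p C_P σ Q C₀ : ℝ} (hp : 1 < p) (hC : 0 < C_P) (hσ : 1 ≤ σ)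
    (hPI : PI μ p C_P σ) (hC₀ : 0 < C₀) (hQ : 0 < Q) (hd : Decay μ Q C₀)
    (u : X → ℝ) (hu : Measurable u)
    (hup : (∫⁻ x, ENNReal.ofReal |u x| ^ p ∂μ) < ⊤) (g : X → ℝ≥0∞) (hg : Measurable g)
    (hug : IsUpperGradient u g) (x z : X) (ρ s : ℝ) (hz : z ∈ ball x ρ) (hs : 0 < s) (hsρ : s ≤ ρ)
    (hρs : ρ ≤ 2 * s) (hsub : ball z s ⊆ ball x ρ) :
    ENNReal.ofReal |(⨍ y in ball z s, u y ∂μ) - ⨍ y in ball x ρ, u y ∂μ| ≤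
      ENNReal.ofReal (2 ^ Q / C₀ * (C_P * (2 * ρ))) *
            (⨍⁻ y in ball x (σ * ρ), g y ^ p ∂μ) ^ (1 / p) := by
  have hρ : 0 < ρ := hs.trans_le hsρ
  have h1 := PI_local hball hp hC hσ hPI u hu hup g hg hug x ρ hρ
  have h2 := avg_le hball hC₀ hd (fun y => ENNReal.ofReal |u y - ⨍ z in ball x ρ, u z ∂μ|) hz hs hsρ hsub
  set c := ⨍ z in ball x ρ, u z ∂μ
  have hi := integrableOn_ball hball hp u hu hup z s hs
  have : IsFiniteMeasure (μ.restrict (ball z s)) := ⟨by simpa using (hball z s hs).2⟩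
  have hm : μ.real (ball z s) ≠ 0 := (ENNReal.toReal_pos (hball z s hs).1.ne' (hball z s hs).2.ne).ne'
  have h3 : (⨍ y in ball z s, u y ∂μ) - c = ⨍ y in ball z s, (u y - c) ∂μ := by
    rw [setAverage_eq, setAverage_eq, integral_sub hi (integrable_const _)]
    simp only [integral_const, smul_eq_mul, measureReal_restrict_apply_univ]
    field_simp
  have h4 : ENNReal.ofReal |⨍ y in ball z s, (u y - c) ∂μ| ≤ ⨍⁻ y in ball z s, ENNReal.ofReal |u y - c| ∂μ := by
    have := enorm_integral_le_lintegral_enorm (μ := ((μ.restrict (ball z s)) Set.univ)⁻¹ • μ.restrict (ball z s)) (fun y => u y - c)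
    simp only [← ofReal_norm, Real.norm_eq_abs] at this
    exact this
  rw [h3]
  refine h4.trans (h2.trans ?_)
  rw [ENNReal.ofReal_mul (by positivity), mul_assoc]
  refine mul_le_mul' (ENNReal.ofReal_le_ofReal ?_) h1
  have : ρ / s ≤ 2 := by rw [div_le_iff₀ hs]; linarith
  gcongr

end

section
variable {X : Type*} [MetricSpace X] [MeasurableSpace X] [BorelSpace X] {μ : Measure X}

lemma limsup_close (m : ℝ → ℝ) (c E r : ℝ) (hr : 0 < r)
    (H : ∀ s, 0 < s → s ≤ r → |m s - c| ≤ E) : |limsup m (𝓝[>] (0 : ℝ)) - c| ≤ E := by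
  have hev : ∀ᶠ s in 𝓝[>] (0 : ℝ), |m s - c| ≤ E := by
    filter_upwards [Ioc_mem_nhdsGT hr] with s hs using H s hs.1 hs.2
  have h1 : ∀ᶠ s in 𝓝[>] (0 : ℝ), m s ≤ c + E := hev.mono fun s hs => by
    have := (abs_le.1 hs).2; linarith
  have h2 : ∀ᶠ s in 𝓝[>] (0 : ℝ), c - E ≤ m s := hev.mono fun s hs => by
    have := (abs_le.1 hs).1; linarith
  have hb1 : IsBoundedUnder (· ≤ ·) (𝓝[>] (0 : ℝ)) m := isBoundedUnder_of_eventually_le h1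
  have hb2 : IsBoundedUnder (· ≥ ·) (𝓝[>] (0 : ℝ)) m := isBoundedUnder_of_eventually_ge h2
  have h3 := limsup_le_of_le hb2.isCoboundedUnder_le h1
  have h4 := le_limsup_of_le hb1 (fun b hb => by
    obtain ⟨s, hs1, hs2⟩ := (hb.and h2).exists
    exact hs2.trans hs1 : ∀ b, (∀ᶠ s in 𝓝[>] (0 : ℝ), m s ≤ b) → c - E ≤ b)
  rw [abs_le]; constructor <;> linarith

lemma sub_mean (hball : BallPos μ) {p C_P σ Q C₀ : ℝ} (hp : 1 < p) (hC : 0 < C_P) (hσ : 1 ≤ σ)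
    (hPI : PI μ p C_P σ) (hC₀ : 0 < C₀) (hQ : 0 < Q) (hpQ : Q < p) (hd : Decay μ Q C₀)
    (u : X → ℝ) (hu : Measurable u)
    (hup : (∫⁻ x, ENNReal.ofReal |u x| ^ p ∂μ) < ⊤) (g : X → ℝ≥0∞) (hg : Measurable g)
    (hug : IsUpperGradient u g) (hgp : ∫⁻ x, g x ^ p ∂μ < ⊤)
    (hprec : ∀ x : X, u x = limsup (fun r => ⨍ y in ball x r, u y ∂μ) (𝓝[>] (0 : ℝ))) :
    ∃ D : ℝ, 0 ≤ D ∧ ∀ (x : X) (r : ℝ), 0 < r →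
      ENNReal.ofReal |u x - ⨍ y in ball x r, u y ∂μ| ≤
        ENNReal.ofReal (D * r) * (⨍⁻ y in ball x (σ * r), g y ^ p ∂μ) ^ (1 / p) := by
  have hp0 : 0 < p := by linarith
  have hα : 0 < 1 - Q / p := by rw [sub_pos, div_lt_one hp0]; exact hpQ
  have hθ : (1 / 2 : ℝ) ^ (1 - Q / p) < 1 := Real.rpow_lt_one (by norm_num) (by norm_num) hα
  set θ := (1 / 2 : ℝ) ^ (1 - Q / p) with hθd
  set K := 2 ^ Q / C₀ * (C_P * 2) with hK
  have hKpos : 0 < K := by positivity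
  refine ⟨K * (C₀⁻¹) ^ (1 / p) / (1 - θ), div_nonneg (by positivity) (by linarith), fun x r hr => ?_⟩
  set A := ⨍⁻ y in ball x (σ * r), g y ^ p ∂μ with hA
  have hσr : 0 < σ * r := by positivity
  have hAtop : A ≠ ⊤ := by
    rw [hA, setLAverage_eq]
    exact ENNReal.div_ne_top ((setLIntegral_le_lintegral _ _).trans_lt hgp).ne (hball x _ hσr).1.ne'
  have hAa : A = ENNReal.ofReal A.toReal := (ENNReal.ofReal_toReal hAtop).symm
  set a := A.toReal with ha
  have ha0 : 0 ≤ a := ENNReal.toReal_nonneg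
  have step : ∀ ρ, 0 < ρ → ρ ≤ r → ∀ s, ρ / 2 ≤ s → s ≤ ρ →
      |(⨍ y in ball x s, u y ∂μ) - ⨍ y in ball x ρ, u y ∂μ| ≤
        (K * (r ^ Q / C₀ * a) ^ (1 / p)) * ρ ^ (1 - Q / p) := by
    intro ρ hρ hρr s hs1 hs2
    have h1 := mean_diff hball hp hC hσ hPI hC₀ hQ hd u hu hup g hg hug x x ρ s
      (mem_ball_self hρ) (by linarith) hs2 (by linarith) (ball_subset_ball hs2)
    have hσρ : 0 < σ * ρ := by positivity
    have hle : σ * ρ ≤ σ * r := by gcongr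
    have h2 := avg_le hball hC₀ hd (fun y => g y ^ p) (mem_ball_self hσr : x ∈ ball x (σ * r))
      hσρ hle (ball_subset_ball hle)
    rw [← hA, hAa, ← ENNReal.ofReal_mul (by positivity),
      show σ * r / (σ * ρ) = r / ρ by field_simp] at h2
    have h3 := h1.trans (mul_le_mul_right (ENNReal.rpow_le_rpow h2 (by positivity : 0 ≤ 1 / p)) _)
    rw [ENNReal.ofReal_rpow_of_nonneg (by positivity) (by positivity),
      ← ENNReal.ofReal_mul (by positivity), ENNReal.ofReal_le_ofReal_iff (by positivity)] at h3
    refine h3.trans_eq ?_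
    have e1 : (r / ρ) ^ Q / C₀ * a = (r ^ Q / C₀ * a) * ρ ^ (-Q) := by
      rw [Real.div_rpow hr.le hρ.le, Real.rpow_neg hρ.le]; ring
    have e2 : (ρ ^ (-Q)) ^ (1 / p) * ρ = ρ ^ (1 - Q / p) := by
      rw [← Real.rpow_mul hρ.le]
      nth_rewrite 2 [← Real.rpow_one ρ]
      rw [← Real.rpow_add hρ]; congr 1; ring
    rw [e1, Real.mul_rpow (by positivity) (by positivity), ← e2, hK]
    ring
  have tel := telescope (fun s => ⨍ y in ball x s, u y ∂μ) (1 - Q / p)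
    (K * (r ^ Q / C₀ * a) ^ (1 / p)) r hα (by positivity) step
  have lim := limsup_close _ _ _ r hr tel
  rw [← hprec x] at lim
  rw [hAa, ENNReal.ofReal_rpow_of_nonneg ha0 (by positivity), ← ENNReal.ofReal_mul (by
    have : 0 < 1 - θ := by linarith
    positivity)]
  refine ENNReal.ofReal_le_ofReal (lim.trans_eq ?_)
  have e1 : (r ^ Q / C₀ * a) ^ (1 / p) = r ^ (Q / p) * (C₀⁻¹) ^ (1 / p) * a ^ (1 / p) := by
    rw [Real.mul_rpow (by positivity) ha0, div_eq_mul_inv, Real.mul_rpow (by positivity) (by positivity),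
      ← Real.rpow_mul hr.le]
    congr 4; ring
  have e2 : r ^ (Q / p) * r ^ (1 - Q / p) = r := by
    rw [← Real.rpow_add hr, add_sub_cancel, Real.rpow_one]
  rw [e1]
  calc _ = K * (C₀⁻¹) ^ (1 / p) / (1 - θ) * (r ^ (Q / p) * r ^ (1 - Q / p)) * a ^ (1 / p) := by ring
    _ = _ := by rw [e2]

lemma pointwise (hball : BallPos μ) {p C_P σ Q C₀ : ℝ} (hp : 1 < p) (hC : 0 < C_P) (hσ : 1 ≤ σ)
    (hPI : PI μ p C_P σ) (hC₀ : 0 < C₀) (hQ : 0 < Q) (hpQ : Q < p) (hd : Decay μ Q C₀)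
    (u : X → ℝ) (hu : Measurable u)
    (hup : (∫⁻ x, ENNReal.ofReal |u x| ^ p ∂μ) < ⊤) (g : X → ℝ≥0∞) (hg : Measurable g)
    (hug : IsUpperGradient u g) (hgp : ∫⁻ x, g x ^ p ∂μ < ⊤)
    (hprec : ∀ x : X, u x = limsup (fun r => ⨍ y in ball x r, u y ∂μ) (𝓝[>] (0 : ℝ))) :
    ∃ D : ℝ, 0 ≤ D ∧ ∀ (x y : X) (r : ℝ), 0 < r → y ∈ ball x r →
      ENNReal.ofReal |u y - u x| ≤
        ENNReal.ofReal (D * r) * (⨍⁻ y in ball x (σ * (2 * r)), g y ^ p ∂μ) ^ (1 / p) := by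
  obtain ⟨D, hD0, hD⟩ := sub_mean hball hp hC hσ hPI hC₀ hQ hpQ hd u hu hup g hg hug hgp hprec
  refine ⟨D * (2 ^ Q / C₀) ^ (1 / p) + 2 ^ Q / C₀ * (C_P * (2 * 2)) + D * 2, by positivity,
    fun x y r hr hy => ?_⟩
  have hp0 : 0 ≤ 1 / p := by have : 0 < p := by linarith
                             positivity
  have hyd := mem_ball.1 hy
  have h1 := hD y r hr
  have h2 := mean_diff hball hp hC hσ hPI hC₀ hQ hd u hu hup g hg hug x y (2 * r) r
    (mem_ball.2 (by linarith)) hr (by linarith) le_rfl (ball_subset_ball' (by linarith))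
  have h3 := hD x (2 * r) (by linarith)
  have hσr : r ≤ σ * r := by nlinarith
  have h4 := avg_le hball hC₀ hd (fun y => g y ^ p) (x := x) (z := y) (ρ := σ * (2 * r)) (s := σ * r)
    (mem_ball.2 (by linarith)) (by linarith) (by linarith) (ball_subset_ball' (by linarith))
  rw [show σ * (2 * r) / (σ * r) = 2 by field_simp] at h4
  set A := ⨍⁻ y in ball x (σ * (2 * r)), g y ^ p ∂μ
  have h5 := h1.trans (mul_le_mul_right (ENNReal.rpow_le_rpow h4 hp0) _)
  rw [ENNReal.mul_rpow_of_nonneg _ _ hp0, ENNReal.ofReal_rpow_of_nonneg (by positivity) hp0, ← mul_assoc,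
    ← ENNReal.ofReal_mul (by positivity)] at h5
  have tri : |u y - u x| ≤ |u y - ⨍ z in ball y r, u z ∂μ| +
      |(⨍ z in ball y r, u z ∂μ) - ⨍ z in ball x (2 * r), u z ∂μ| +
      |u x - ⨍ z in ball x (2 * r), u z ∂μ| := by
    rw [abs_sub_comm (u x)]
    have := abs_sub_le (u y) (⨍ z in ball y r, u z ∂μ) (u x)
    have := abs_sub_le (⨍ z in ball y r, u z ∂μ) (⨍ z in ball x (2 * r), u z ∂μ) (u x)
    linarith
  refine (ENNReal.ofReal_le_ofReal tri).trans ?_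
  rw [ENNReal.ofReal_add (by positivity) (by positivity), ENNReal.ofReal_add (by positivity) (by positivity)]
  refine (add_le_add (add_le_add h5 h2) h3).trans_eq ?_
  rw [← add_mul, ← add_mul, ← ENNReal.ofReal_add (by positivity) (by positivity),
    ← ENNReal.ofReal_add (by positivity) (by positivity)]
  congr 2; ring

lemma dyadic (δ r : ℝ) (hr : 0 < r) (hrδ : r < δ) :
    ∃ k : ℕ, δ * (1 / 2) ^ k / 2 ≤ r ∧ r ≤ δ * (1 / 2) ^ k := by
  have hδ : 0 < δ := hr.trans hrδ
  obtain ⟨k, h1, h2⟩ := exists_nat_pow_near_of_lt_one (x := r / δ) (y := 1 / 2) (by positivity)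
    (by rw [div_le_one hδ]; exact hrδ.le) (by norm_num) (by norm_num)
  rw [lt_div_iff₀ hδ, pow_succ] at h1
  rw [div_le_iff₀ hδ] at h2
  exact ⟨k, by linarith, by linarith⟩

/-- Maximal-type majorant. -/
lemma majorant (hball : BallPos μ) {p σ Q C₀ δ : ℝ} (hp : 1 < p) (hσ : 1 ≤ σ) (hC₀ : 0 < C₀)
    (hQ : 0 < Q) (hδ : 0 < δ) (hd : Decay μ Q C₀) (f : X → ℝ≥0∞) (hf : Measurable f)
    (hfi : ∫⁻ x, f x ∂μ < ⊤) :
    ∃ S : X → ℝ≥0∞, ∫⁻ x, S x ∂μ < ⊤ ∧ ∀ x r, 0 < r → r < δ →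
      ENNReal.ofReal (r ^ (p / 2)) * ⨍⁻ y in ball x (σ * (2 * r)), f y ∂μ ≤ S x := by
  have hσ0 : 0 < σ := by linarith
  have hp0 : 0 < p := by linarith
  have hR : ∀ k : ℕ, 0 < σ * (2 * (δ * (1 / 2) ^ k)) := fun k => by positivity
  choose N hN1 hN2 hN3 using fun k : ℕ => exists_majorant hball hC₀ hd f hf _ (hR k)
  set c := ENNReal.ofReal (2 ^ Q / C₀) with hc
  let w : ℕ → ℝ≥0∞ := fun k => ENNReal.ofReal ((δ * (1 / 2) ^ k) ^ (p / 2)) * c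
  refine ⟨fun x => ∑' k, w k * N k x, ?_, fun x r hr hrδ => ?_⟩
  · rw [lintegral_tsum fun k => ((hN1 k).const_mul _).aemeasurable]
    have hw : ∑' k, w k < ⊤ := by
      simp only [w]
      rw [ENNReal.tsum_mul_right]
      refine ENNReal.mul_lt_top ?_ ENNReal.ofReal_lt_top
      have e : ∀ k : ℕ, (δ * (1 / 2) ^ k) ^ (p / 2) = δ ^ (p / 2) * ((1 / 2 : ℝ) ^ (p / 2)) ^ k := by
        intro k
        rw [Real.mul_rpow hδ.le (by positivity), ← Real.rpow_natCast, ← Real.rpow_natCast,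
          ← Real.rpow_mul (by norm_num), ← Real.rpow_mul (by norm_num), mul_comm (k : ℝ)]
      simp only [e]
      have hs : Summable fun k : ℕ => δ ^ (p / 2) * ((1 / 2 : ℝ) ^ (p / 2)) ^ k :=
        (summable_geometric_of_lt_one (by positivity)
          (Real.rpow_lt_one (by norm_num) (by norm_num) (by positivity))).mul_left _
      exact hs.tsum_ofReal_lt_top
    calc ∑' k, ∫⁻ x, w k * N k x ∂μ ≤ ∑' k, w k * (ENNReal.ofReal C₀⁻¹ * ∫⁻ x, f x ∂μ) := by
          refine ENNReal.tsum_le_tsum fun k => ?_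
          rw [lintegral_const_mul _ (hN1 k)]
          gcongr
          exact hN3 k
      _ < ⊤ := by
          rw [ENNReal.tsum_mul_right]
          exact ENNReal.mul_lt_top hw (ENNReal.mul_lt_top ENNReal.ofReal_lt_top hfi)
  · obtain ⟨k, hk1, hk2⟩ := dyadic δ r hr hrδ
    set ρ := δ * (1 / 2) ^ k with hρ
    have hle : σ * (2 * r) ≤ σ * (2 * ρ) := by gcongr
    have h1 := avg_le hball hC₀ hd f (mem_ball_self (hR k) : x ∈ ball x (σ * (2 * ρ)))
      (by positivity : 0 < σ * (2 * r)) hle (ball_subset_ball hle)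
    have h2 : σ * (2 * ρ) / (σ * (2 * r)) ≤ 2 := by
      rw [div_le_iff₀ (by positivity)]
      nlinarith
    have h3 : ENNReal.ofReal ((σ * (2 * ρ) / (σ * (2 * r))) ^ Q / C₀) ≤ c := by
      refine ENNReal.ofReal_le_ofReal ?_
      have : 0 ≤ σ * (2 * ρ) / (σ * (2 * r)) := by positivity
      gcongr
    refine le_trans ?_ (ENNReal.le_tsum k)
    calc _ ≤ ENNReal.ofReal (ρ ^ (p / 2)) * (c * N k x) := by
          refine mul_le_mul' (ENNReal.ofReal_le_ofReal (by gcongr)) (h1.trans (mul_le_mul' h3 (hN2 k x)))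
      _ = _ := by simp only [w]; rw [mul_assoc]

lemma lintegral_rpow_lt_top (β δ : ℝ) (hβ : 0 < β) (hδ : 0 < δ) :
    ∫⁻ r in Set.Ioo (0 : ℝ) δ, ENNReal.ofReal (r ^ (β - 1)) < ⊤ := by
  have h := (intervalIntegral.intervalIntegrable_rpow' (a := 0) (b := δ) (r := β - 1) (by linarith))
  rw [intervalIntegrable_iff_integrableOn_Ioo_of_le hδ.le] at h
  exact h.lintegral_lt_top

end

section
variable {X : Type*} [MetricSpace X] [MeasurableSpace X] [BorelSpace X] {μ : Measure X}

lemma integrand_le (hball : BallPos μ) {p h D : ℝ} (hp : 1 < p) (hh : 0 < h) (hD : 0 ≤ D)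
    (u : X → ℝ) (x : X) (r : ℝ) (hr : 0 < r) (A S : ℝ≥0∞)
    (H : ∀ y ∈ ball x r, ENNReal.ofReal |u y - u x| ≤ ENNReal.ofReal (D * r) * A ^ (1 / p))
    (HS : ENNReal.ofReal (r ^ (p / 2)) * A ≤ S) :
    (⨍⁻ y in ball x r, ENNReal.ofReal |u y - u x| ^ h ∂μ) ^ (p / (h * (p - 1)))
          / ENNReal.ofReal r ≤
      (ENNReal.ofReal (D ^ (p / (p - 1))) * S ^ (1 / (p - 1))) *
        ENNReal.ofReal (r ^ (p / (2 * (p - 1)) - 1)) := by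
  have hp0 : 0 < p := by linarith
  have hp1 : 0 < p - 1 := by linarith
  have h1 : ⨍⁻ y in ball x r, ENNReal.ofReal |u y - u x| ^ h ∂μ ≤
      (ENNReal.ofReal (D * r) * A ^ (1 / p)) ^ h := by
    rw [setLAverage_eq]
    refine ENNReal.div_le_of_le_mul ?_
    rw [← setLIntegral_const]
    exact setLIntegral_mono' measurableSet_ball fun y hy => ENNReal.rpow_le_rpow (H y hy) hh.le
  have h2 : (⨍⁻ y in ball x r, ENNReal.ofReal |u y - u x| ^ h ∂μ) ^ (p / (h * (p - 1))) ≤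
      ENNReal.ofReal ((D * r) ^ (p / (p - 1))) * A ^ (1 / (p - 1)) := by
    refine (ENNReal.rpow_le_rpow h1 (by positivity)).trans_eq ?_
    rw [← ENNReal.rpow_mul, show h * (p / (h * (p - 1))) = p / (p - 1) by field_simp,
      ENNReal.mul_rpow_of_nonneg _ _ (by positivity), ← ENNReal.rpow_mul,
      show 1 / p * (p / (p - 1)) = 1 / (p - 1) by field_simp,
      ENNReal.ofReal_rpow_of_nonneg (by positivity) (by positivity)]
  have h3 := ENNReal.rpow_le_rpow HS (by positivity : 0 ≤ 1 / (p - 1))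
  rw [ENNReal.mul_rpow_of_nonneg _ _ (by positivity),
    ENNReal.ofReal_rpow_of_nonneg (by positivity) (by positivity), ← Real.rpow_mul hr.le,
    show p / 2 * (1 / (p - 1)) = p / (2 * (p - 1)) by field_simp] at h3
  set β := p / (2 * (p - 1)) with hβ
  have e : (D * r) ^ (p / (p - 1)) * r⁻¹ = D ^ (p / (p - 1)) * r ^ (β - 1) * r ^ β := by
    rw [Real.mul_rpow hD hr.le, mul_assoc, mul_assoc, ← Real.rpow_add hr, ← Real.rpow_neg_one r,
      ← Real.rpow_add hr]
    congr 2; rw [hβ]; field_simp; ring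
  calc _ ≤ ENNReal.ofReal ((D * r) ^ (p / (p - 1))) * A ^ (1 / (p - 1)) * ENNReal.ofReal r⁻¹ := by
        rw [div_eq_mul_inv, ENNReal.ofReal_inv_of_pos hr]; gcongr
    _ = ENNReal.ofReal ((D * r) ^ (p / (p - 1)) * r⁻¹) * A ^ (1 / (p - 1)) := by
        rw [ENNReal.ofReal_mul (by positivity)]; ring
    _ = ENNReal.ofReal (D ^ (p / (p - 1))) * ENNReal.ofReal (r ^ (β - 1)) *
          (ENNReal.ofReal (r ^ β) * A ^ (1 / (p - 1))) := by
        rw [e, ENNReal.ofReal_mul (by positivity), ENNReal.ofReal_mul (by positivity)]; ring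
    _ ≤ ENNReal.ofReal (D ^ (p / (p - 1))) * ENNReal.ofReal (r ^ (β - 1)) * S ^ (1 / (p - 1)) := by
        gcongr
    _ = _ := by ring

end

/-- **Main theorem, part (ii).** Let `(X, d, μ)` be complete, with a Borel
regular doubling measure positive and finite on balls, supporting a `p`-Poincaré inequality
(`1 < p < ∞`) and having relative lower volume decay of order `Q > 0`. Suppose `p > Q`, let
`h > 0`, `0 < δ < ∞`, and let `u ∈ N^{1,p}(X)` be pointwise defined everywhere by its precise
representative. Then
`∫_X ( ∫_0^δ ( ⨍_{B(x,r)} |u − u(x)|^h dμ )^{p/(h(p−1))} dr/r )^{p−1} dμ(x) < ∞`. -/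
theorem stmt_10 {X : Type*} [MetricSpace X] [CompleteSpace X]
    [MeasurableSpace X] [BorelSpace X] (μ : Measure X)
    (hreg : ∀ s : Set X, ∃ B : Set X, MeasurableSet B ∧ s ⊆ B ∧ μ B = μ s)
    (hball : ∀ (x : X) (r : ℝ), 0 < r → 0 < μ (ball x r) ∧ μ (ball x r) < ⊤)
    (hdbl : ∃ Cμ : ℝ≥0∞, 1 ≤ Cμ ∧ ∀ (x : X) (r : ℝ), 0 < r →
      μ (ball x (2 * r)) ≤ Cμ * μ (ball x r))
    (p h Q δ : ℝ) (hQpos : 0 < Q) (hp : 1 < p) (hpQ : Q < p) (hh : 0 < h) (hδ : 0 < δ)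
    (hQdecay : ∃ C₀ : ℝ, 0 < C₀ ∧ ∀ (x y : X) (R r : ℝ), 0 < R → y ∈ ball x R →
      0 < r → r ≤ R → ENNReal.ofReal (C₀ * (r / R) ^ Q) * μ (ball x R) ≤ μ (ball y r))
    (hPI : ∃ C_P : ℝ, 0 < C_P ∧ ∃ σ : ℝ, 1 ≤ σ ∧ ∀ (x : X) (r : ℝ), 0 < r →
      ∀ (v : X → ℝ) (ρ : X → ℝ≥0∞), Integrable v μ → Measurable ρ → IsUpperGradient v ρ →
        ⨍⁻ y in ball x r, ENNReal.ofReal |v y - ⨍ z in ball x r, v z ∂μ| ∂μ ≤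
          ENNReal.ofReal (C_P * Metric.diam (ball x r)) *
            (⨍⁻ y in ball x (σ * r), ρ y ^ p ∂μ) ^ (1 / p))
    (u : X → ℝ) (hu : MemN1p μ p u)
    (hprec : ∀ x : X, u x = limsup (fun r => ⨍ y in ball x r, u y ∂μ) (𝓝[>] (0 : ℝ))) :
    ∫⁻ x, (∫⁻ r in Set.Ioo (0 : ℝ) δ,
        (⨍⁻ y in ball x r, ENNReal.ofReal |u y - u x| ^ h ∂μ) ^ (p / (h * (p - 1)))
          / ENNReal.ofReal r) ^ (p - 1) ∂μ < ⊤ := by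
  obtain ⟨C₀, hC₀, hd⟩ := hQdecay
  obtain ⟨C_P, hC, σ, hσ, hPI⟩ := hPI
  obtain ⟨hum, hup, g, hg, hug, hgp⟩ := hu
  have hp0 : 0 < p := by linarith
  have hp1 : 0 < p - 1 := by linarith
  obtain ⟨D, hD, HD⟩ := pointwise (μ := μ) hball hp hC hσ hPI hC₀ hQpos hpQ hd u hum hup g hg hug hgp hprec
  obtain ⟨S, hS, HS⟩ := majorant (μ := μ) hball hp hσ hC₀ hQpos hδ hd (fun y => g y ^ p)
    (hg.pow_const p) hgp
  have hJ := lintegral_rpow_lt_top (p / (2 * (p - 1))) δ (by positivity) hδ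
  set J := ∫⁻ r in Set.Ioo (0 : ℝ) δ, ENNReal.ofReal (r ^ (p / (2 * (p - 1)) - 1)) with hJd
  set c := (ENNReal.ofReal (D ^ (p / (p - 1))) * J) ^ (p - 1) with hc
  have hctop : c ≠ ⊤ :=
    ENNReal.rpow_ne_top_of_nonneg hp1.le (ENNReal.mul_lt_top ENNReal.ofReal_lt_top hJ).ne
  calc _ ≤ ∫⁻ x, c * S x ∂μ := by
        refine lintegral_mono fun x => ?_
        have h1 : (∫⁻ r in Set.Ioo (0 : ℝ) δ,
            (⨍⁻ y in ball x r, ENNReal.ofReal |u y - u x| ^ h ∂μ) ^ (p / (h * (p - 1)))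
            / ENNReal.ofReal r) ≤
            (ENNReal.ofReal (D ^ (p / (p - 1))) * S x ^ (1 / (p - 1))) * J := by
          rw [hJd, ← lintegral_const_mul _ (by fun_prop)]
          exact setLIntegral_mono' measurableSet_Ioo fun r hr =>
            integrand_le hball hp hh hD u x r hr.1 _ _ (fun y hy => HD x y r hr.1 hy)
              (HS x r hr.1 hr.2)
        refine (ENNReal.rpow_le_rpow h1 hp1.le).trans_eq ?_
        rw [mul_right_comm, ENNReal.mul_rpow_of_nonneg _ _ hp1.le, ← hc, ← ENNReal.rpow_mul,
          one_div_mul_cancel hp1.ne', ENNReal.rpow_one]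
    _ = c * ∫⁻ x, S x ∂μ := lintegral_const_mul' _ _ hctop
    _ < ⊤ := ENNReal.mul_lt_top hctop.lt_top hS
end
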